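/- Let K be an algebraically closed field and A = K⟨x,y⟩ the free algebra on x, y. Let f_1, …, f_ξ ∈ A be homogeneous of positive degree, let I be the two-sided ideal they generate, let r_i be the number of indices j with 2^i < deg f_j ≤ 2^{i+1}, let Y = { i ≥ 1 : r_i ≠ 0 }, and assume every deg f_j satisfies 2^n + 2^{n-1} ≤ deg f_j ≤ 2^n + 2^{n-1} + 2^{n-2} for some integer n ≥ 2. Assume that for all n ∈ Y and all m ∈ {0} ∪ Y with m < n one has 2^{3n+4} · ∏_{i∈Y, i<n} r_i^{32} < r_n < 2^{2^{n-m-3}}. Then: (a) there exist two monomials m_1, m_2 ∈ A of the same degree whose images in A/I generate a free subalgebra; in particular the image of m_1 in A/I is not nilpotent (so A/I contains a non-nilpotent element of positive degree); (b) there exists a homogeneous two-sided ideal J of A with I ⊆ J such that A/J is infinite-dimensional over K, prime, left and right Noetherian, has linear growth, and satisfies a polynomial identity. -/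

import Mathlib

/-
Formalization of statements from:
"Golod-Shafarevich algebras of a reduced number of defining relations" (A. Smoktunowicz).

`FA K` is the free associative unital `K`-algebra `A = K⟨x,y⟩` on two generators
(`FreeAlgebra.ι K 0` and `FreeAlgebra.ι K 1`), graded with the generators in degree 1.
-/

open scoped Pointwise Classical

noncomputable section

/-- The free associative unital `K`-algebra on two generators. -/
abbrev FA (K : Type) [Field K] : Type := FreeAlgebra K (Fin 2)

variable (K : Type) [Field K]

/-- The set of monomials of degree `k` in the free algebra on two generators. -/
def Mon (k : ℕ) : Set (FA K) :=
  { m | ∃ w : List (Fin 2), w.length = k ∧ m = (w.map (FreeAlgebra.ι K)).prod }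

/-- `Adeg K k` is the `k`-th homogeneous component `A(k)`: the span of the monomials of
degree `k`. -/
def Adeg (k : ℕ) : Submodule K (FA K) :=
  Submodule.span K (Mon K k)

/-- Properties (1)-(4) of the families `U(2^m)`, `V(2^m)` of subspaces of `A(2^m)`
(Section 1 of the paper):
(1) `V(2^m)` is spanned by monomials (of degree `2^m`);
(2) `V(2^m) + U(2^m) = A(2^m)` and `V(2^m) ∩ U(2^m) = 0`;
(3) `A(2^{m-1})U(2^{m-1}) + U(2^{m-1})A(2^{m-1}) ⊆ U(2^m)`;
(4) `V(2^m) ⊆ V(2^{m-1})V(2^{m-1})`;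
with `V(2^0) = Kx + Ky` and `U(2^0) = 0`. -/
def UVCond (U V : ℕ → Submodule K (FA K)) : Prop :=
  V 0 = Submodule.span K {FreeAlgebra.ι K 0, FreeAlgebra.ι K 1} ∧
  U 0 = ⊥ ∧
  ∀ m : ℕ, 1 ≤ m →
    (∃ s ⊆ Mon K (2 ^ m), V m = Submodule.span K s) ∧
    U m ≤ Adeg K (2 ^ m) ∧
    V m ⊔ U m = Adeg K (2 ^ m) ∧
    V m ⊓ U m = ⊥ ∧
    Adeg K (2 ^ (m - 1)) * U (m - 1) ⊔ U (m - 1) * Adeg K (2 ^ (m - 1)) ≤ U m ∧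
    V m ≤ V (m - 1) * V (m - 1)

/-- The homogeneous component `E(k)` (as a set), for `k ≥ 1`.  For the unique `n` with
`2^(n-1) ≤ k < 2^n` (i.e. `n = Nat.log 2 k + 1`) it consists of those `r ∈ A(k)` with
`A r A ∩ A(2^(n+1)) ⊆ U(2^n)A(2^n) + A(2^n)U(2^n)`; here `A r A` is the two-sided ideal
generated by `r`, realized as the subspace `⊤ * span{r} * ⊤`. -/
def ESet (U : ℕ → Submodule K (FA K)) (k : ℕ) : Set (FA K) :=
  { r | r ∈ Adeg K k ∧
    (⊤ : Submodule K (FA K)) * Submodule.span K {r} * ⊤ ⊓ Adeg K (2 ^ (Nat.log 2 k + 2)) ≤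
      U (Nat.log 2 k + 1) * Adeg K (2 ^ (Nat.log 2 k + 1)) ⊔
        Adeg K (2 ^ (Nat.log 2 k + 1)) * U (Nat.log 2 k + 1) }

/-- The graded subspace `E = ⊕_{k ≥ 1} E(k)` (each `E(k)` is a subspace, so the span of the
union of the `E(k)` is their direct sum). -/
def Esub (U : ℕ → Submodule K (FA K)) : Submodule K (FA K) :=
  Submodule.span K (⋃ k ∈ Set.Ici 1, ESet K U k)

/-- Auxiliary: the product of the `V(2^p)` over the set bits of `k`, lowest bit first,
with bit positions shifted by `i`. -/
def prodLow (V : ℕ → Submodule K (FA K)) (i k : ℕ) : Submodule K (FA K) :=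
  if _h : k = 0 then 1
  else (if k % 2 = 1 then V i else 1) * prodLow V (i + 1) (k / 2)
termination_by k
decreasing_by exact Nat.div_lt_self (Nat.pos_of_ne_zero _h) one_lt_two

/-- Auxiliary: the product of the `V(2^p)` over the set bits of `k`, highest bit first. -/
def prodHigh (V : ℕ → Submodule K (FA K)) (i k : ℕ) : Submodule K (FA K) :=
  if _h : k = 0 then 1
  else prodHigh V (i + 1) (k / 2) * (if k % 2 = 1 then V i else 1)
termination_by k
decreasing_by exact Nat.div_lt_self (Nat.pos_of_ne_zero _h) one_lt_two

/-- `V^<(k) = V(2^{p_1}) ⋯ V(2^{p_t})` where `k = 2^{p_1} + ⋯ + 2^{p_t}` in binary with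
`p_1 < ⋯ < p_t`; `V^<(0) = K·1`. -/
def Vlt (V : ℕ → Submodule K (FA K)) (k : ℕ) : Submodule K (FA K) := prodLow K V 0 k

/-- `V^>(k) = V(2^{p_t}) ⋯ V(2^{p_1})`; `V^>(0) = K·1`. -/
def Vgt (V : ℕ → Submodule K (FA K)) (k : ℕ) : Submodule K (FA K) := prodHigh K V 0 k

/-- `U^<(k) = Σ_i A(2^{p_1}+⋯+2^{p_{i-1}}) U(2^{p_i}) A(2^{p_{i+1}}+⋯+2^{p_t})`
(for each set bit `p_i` of `k`, the lower part of `k` is `k % 2^{p_i}` and the upper part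
is `k - k % 2^{p_i} - 2^{p_i}`); `U^<(0) = 0`. -/
def Ult (U : ℕ → Submodule K (FA K)) (k : ℕ) : Submodule K (FA K) :=
  ⨆ (p : ℕ) (_ : k.testBit p),
    Adeg K (k % 2 ^ p) * U p * Adeg K (k - k % 2 ^ p - 2 ^ p)

/-- `U^>(k) = Σ_i A(2^{p_t}+⋯+2^{p_{i+1}}) U(2^{p_i}) A(2^{p_{i-1}}+⋯+2^{p_1})`;
`U^>(0) = 0`. -/
def Ugt (U : ℕ → Submodule K (FA K)) (k : ℕ) : Submodule K (FA K) :=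
  ⨆ (p : ℕ) (_ : k.testBit p),
    Adeg K (k - k % 2 ^ p - 2 ^ p) * U p * Adeg K (k % 2 ^ p)

/-- The Capelli polynomial
`d_n(x_1,…,x_n; y_1,…,y_n) = Σ_{σ ∈ Sym(n)} sgn(σ) x_{σ(1)} y_1 x_{σ(2)} y_2 ⋯ x_{σ(n)} y_n`,
evaluated in a ring. -/
def capelli {R : Type*} [Ring R] (n : ℕ) (x y : Fin n → R) : R :=
  ∑ σ : Equiv.Perm (Fin n),
    (Equiv.Perm.sign σ : ℤ) • ((List.finRange n).map fun i => x (σ i) * y i).prod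

/-- The quotient map `R → R ⧸ c` (for a ring congruence `c`) as a `K`-linear map. -/
def mkLin {R : Type*} [Semiring R] [Algebra K R] (c : RingCon R) :
    R →ₗ[K] c.Quotient where
  toFun := RingCon.toQuotient
  map_add' _ _ := rfl
  map_smul' _ _ := rfl

/-- A two-sided ideal of the free algebra is homogeneous iff it is spanned by its
homogeneous elements. -/
def IsHomogTSI (J : TwoSidedIdeal (FA K)) : Prop :=
  (J : Set (FA K)) ⊆ ↑(Submodule.span K {a : FA K | a ∈ J ∧ ∃ n, a ∈ Adeg K n})

/-- `S = ⋃_{n ∈ Y} {n - e(n) - 1, …, n - 1}`. -/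
def SetS (Y : Set ℕ) (e : ℕ → ℕ) : Set ℕ :=
  ⋃ n ∈ Y, Set.Icc (n - e n - 1) (n - 1)

/-- Conditions (1)-(8) of Theorem 4.1 of the paper, at index `m`, for the families
`F(2^m)`, `U(2^m)`, `V(2^m)` of subspaces of `A(2^m)`:
(1) `dim V(2^m) = 2` if `m ∉ S` and (in case `Y` is finite) `m ≤ max Y`;
(2) `dim V(2^{k-e(k)-1+j}) = 2^{2^j}` for all `k ∈ Y` and `0 ≤ j ≤ e(k)`;
(3) `V(2^m)` is spanned by monomials;
(4) `F(2^m) ⊆ U(2^m)` for `m ∈ Y`, and `F(2^m) = 0` for `m ∉ Y`;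
(5) `V(2^m) ⊕ U(2^m) = A(2^m)`;
(6) `A(2^{m-1})U(2^{m-1}) + U(2^{m-1})A(2^{m-1}) ⊆ U(2^m)`;
(7) `V(2^m) ⊆ V(2^{m-1})V(2^{m-1})`;
(8) if `Y` is finite and `m > max Y`, then `dim V(2^m) = 1`. -/
def Conds (Y : Set ℕ) (e : ℕ → ℕ) (F U V : ℕ → Submodule K (FA K)) (m : ℕ) : Prop :=
  (m ∉ SetS Y e → (Y.Finite → ∃ k ∈ Y, m ≤ k) → Module.finrank K (V m) = 2) ∧
  (∀ k ∈ Y, ∀ j ≤ e k, k - e k - 1 + j = m → Module.finrank K (V m) = 2 ^ 2 ^ j) ∧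
  (∃ s ⊆ Mon K (2 ^ m), V m = Submodule.span K s) ∧
  (m ∈ Y → F m ≤ U m) ∧ (m ∉ Y → F m = ⊥) ∧
  U m ≤ Adeg K (2 ^ m) ∧
  V m ⊔ U m = Adeg K (2 ^ m) ∧ V m ⊓ U m = ⊥ ∧
  (Adeg K (2 ^ (m - 1)) * U (m - 1) ⊔ U (m - 1) * Adeg K (2 ^ (m - 1)) ≤ U m) ∧
  V m ≤ V (m - 1) * V (m - 1) ∧
  (Y.Finite → (∀ k ∈ Y, k < m) → Module.finrank K (V m) = 1)

section CommonZeros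

variable {K}

theorem MvPolynomial.height_vanishingIdeal_singleton_le {σ : Type*} (x y : σ → K) :
    (MvPolynomial.vanishingIdeal K {x} : Ideal (MvPolynomial σ K)).height ≤
      (MvPolynomial.vanishingIdeal K {y} : Ideal (MvPolynomial σ K)).height := by
  let φ (z : σ → K) : MvPolynomial σ K →ₐ[K] MvPolynomial σ K :=
    MvPolynomial.aeval fun i => MvPolynomial.X i + MvPolynomial.C (z i)
  have hφ (z : σ → K) : (φ z).comp (φ (-z)) = AlgHom.id K _ := by
    ext i : 1
    simp [φ]
  have hφ' (z : σ → K) : (φ (-z)).comp (φ z) = AlgHom.id K _ := by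
    simpa using hφ (-z)
  let e : MvPolynomial σ K ≃ₐ[K] MvPolynomial σ K :=
    AlgEquiv.ofAlgHom (φ (y - x)) (φ (-(y - x))) (hφ _) (hφ' _)
  have he : (MvPolynomial.vanishingIdeal K {y} : Ideal (MvPolynomial σ K)) =
      (MvPolynomial.vanishingIdeal K {x}).comap (e : MvPolynomial σ K ≃+* MvPolynomial σ K) := by
    have h : (MvPolynomial.aeval x).comp (φ (y - x)) = MvPolynomial.aeval (R := K) y := by
      ext i
      simp [φ]
    ext p
    rw [Ideal.mem_comap, MvPolynomial.mem_vanishingIdeal_singleton_iff,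
      MvPolynomial.mem_vanishingIdeal_singleton_iff, ← h]
    rfl
  rw [he, RingEquiv.height_comap]

theorem MvPolynomial.height_vanishingIdeal_singleton [IsAlgClosed K] {n : ℕ} (x : Fin n → K) :
    (n : ℕ∞) ≤ (MvPolynomial.vanishingIdeal K {x} : Ideal (MvPolynomial (Fin n) K)).height := by
  have h1 : ringKrullDim (MvPolynomial (Fin n) K) = n := by
    rw [MvPolynomial.ringKrullDim_of_isNoetherianRing, ringKrullDim_eq_zero_of_field]
    simp
  have h2 : ringKrullDim (MvPolynomial (Fin n) K) ≤
      ((MvPolynomial.vanishingIdeal K {x} : Ideal (MvPolynomial (Fin n) K)).height : ℕ∞) := by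
    rw [ringKrullDim_le_iff_isMaximal_height_le]
    intro m hm
    obtain ⟨y, rfl⟩ := MvPolynomial.isMaximal_iff_eq_vanishingIdeal_singleton.mp hm
    exact_mod_cast MvPolynomial.height_vanishingIdeal_singleton_le y x
  rw [h1] at h2
  exact_mod_cast h2

/-- Over an algebraically closed field, fewer than `dim Q` quadratic forms on `Q` have a common
nontrivial zero. -/
theorem exists_ne_zero_common_isotropic [IsAlgClosed K] {Q : Type*} [AddCommGroup Q] [Module K Q]
    [FiniteDimensional K Q] {ι : Type*} [Fintype ι] (T : ι → Q →ₗ[K] Q →ₗ[K] K)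
    (h : Fintype.card ι < Module.finrank K Q) :
    ∃ g : Q, g ≠ 0 ∧ ∀ i, T i g g = 0 := by
  by_contra! hcon
  let n := Module.finrank K Q
  let b : Module.Basis (Fin n) K Q := Module.finBasis K Q
  let F : ι → MvPolynomial (Fin n) K := fun i =>
    ∑ p, ∑ q, MvPolynomial.C (T i (b p) (b q)) * MvPolynomial.X p * MvPolynomial.X q
  have hF : ∀ i (x : Fin n → K), MvPolynomial.aeval x (F i) =
      T i (∑ p, x p • b p) (∑ p, x p • b p) := by
    intro i x
    simp only [F, map_sum, map_mul, MvPolynomial.aeval_C, MvPolynomial.aeval_X,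
      LinearMap.sum_apply, map_smul, LinearMap.smul_apply, smul_eq_mul, Algebra.algebraMap_self,
      RingHom.id_apply]
    rw [Finset.sum_comm]
    refine Finset.sum_congr rfl fun p _ => ?_
    rw [Finset.mul_sum]
    exact Finset.sum_congr rfl fun q _ => by ring
  have hz : MvPolynomial.zeroLocus K (Ideal.span (Set.range F)) = {0} := by
    rw [MvPolynomial.zeroLocus_span]
    ext x
    simp only [Set.forall_mem_range, Set.mem_ofPred_eq, Set.mem_singleton_iff, hF]
    constructor
    · intro hx
      by_contra hne
      obtain ⟨i, hi⟩ := hcon (∑ p, x p • b p) fun h0 => hne <| by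
        ext p
        have := congrArg (fun v => b.repr v p) h0
        simpa [Finsupp.single_apply] using this
      exact hi (hx i)
    · rintro rfl i
      simp
  have hmin : (MvPolynomial.vanishingIdeal K {(0 : Fin n → K)} : Ideal (MvPolynomial (Fin n) K)) ∈
      (Ideal.span (Set.range F)).minimalPrimes := by
    rw [← Ideal.radical_minimalPrimes, ← MvPolynomial.vanishingIdeal_zeroLocus_eq_radical (K := K),
      hz, Ideal.minimalPrimes_eq_subsingleton_self]
    rfl
  have h1 := Ideal.height_le_card_of_mem_minimalPrimes_span (Set.finite_range F) hmin
  have h2 := MvPolynomial.height_vanishingIdeal_singleton (0 : Fin n → K)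
  have h3 : n ≤ (Set.range F).ncard := by exact_mod_cast h2.trans h1
  have h4 : (Set.range F).ncard ≤ Fintype.card ι := by
    rw [← Set.image_univ]
    refine (Set.ncard_image_le Set.finite_univ).trans ?_
    simp [Set.ncard_univ]
  omega

end CommonZeros

section GradedNoetherian

open Polynomial in
/-- If left multiplication by `s` carries finitely many finite-dimensional subspaces `G n`, `n < M`,
onto everything, then `R` is left Noetherian. -/
theorem isNoetherianRing_of_mul_surjective {R : Type*} [Ring R] [Algebra K R]
    (G : ℕ → Submodule K R) (hG : ∀ n, (G n).FG) (htop : ⨆ n, G n = ⊤)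
    (s : R) (q M : ℕ) (hq : 1 ≤ q)
    (hs : ∀ n, M ≤ n → ∀ a ∈ G (n + q), ∃ b ∈ G n, s * b = a) : IsNoetherianRing R := by
  let : Module K[X] R := Module.compHom R (aeval s : K[X] →ₐ[K] R).toRingHom
  have hsm : ∀ (p : K[X]) (a : R), p • a = aeval s p * a := fun _ _ => rfl
  have : IsScalarTower K[X] R R := ⟨fun p a b => by simp [hsm, mul_assoc]⟩
  choose t ht using hG
  let T : Finset R := (Finset.range (M + q)).biUnion t
  have hT : ∀ n a, a ∈ G n → a ∈ Submodule.span K[X] (T : Set R) := by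
    intro n
    induction n using Nat.strong_induction_on with
    | _ n ih =>
      intro a ha
      by_cases hn : n < M + q
      · rw [← ht] at ha
        induction ha using Submodule.span_induction with
        | mem x hx =>
          exact Submodule.subset_span (Finset.mem_coe.2
            (Finset.mem_biUnion.2 ⟨n, Finset.mem_range.2 hn, hx⟩))
        | zero => exact zero_mem _
        | add x y _ _ hx hy => exact add_mem hx hy
        | smul c x _ hx =>
          have : c • x = (C c : K[X]) • x := by simp [hsm, Algebra.smul_def]
          rw [this]
          exact Submodule.smul_mem _ _ hx
      · obtain ⟨m, rfl⟩ : ∃ m, n = m + q := ⟨n - q, by omega⟩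
        obtain ⟨b, hb, rfl⟩ := hs m (by omega) a ha
        have : s * b = (X : K[X]) • b := by simp [hsm]
        rw [this]
        exact Submodule.smul_mem _ _ (ih m (by omega) b hb)
  have : Module.Finite K[X] R := by
    refine ⟨⟨T, eq_top_iff.2 fun a _ => ?_⟩⟩
    have ha : a ∈ ⨆ n, G n := htop ▸ Submodule.mem_top
    induction ha using Submodule.iSup_induction' with
    | mem n x hx => exact hT n x hx
    | zero => exact zero_mem _
    | add x y _ _ hx hy => exact add_mem (hx trivial) (hy trivial)
  exact isNoetherian_of_tower K[X] inferInstance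

/-- A bounded sequence of naturals with `g n ≤ g (n + q)` is eventually `q`-periodic. -/
theorem exists_forall_eq_add_of_bounded (g : ℕ → ℕ) (q c : ℕ) (h : ∀ n, g n ≤ g (n + q))
    (hc : ∀ n, g n ≤ c) : ∃ M, ∀ n, M ≤ n → g (n + q) = g n := by
  let S : ℕ → ℕ := fun n => ∑ i ∈ Finset.range q, g (n + i)
  have hS : ∀ n, S (n + 1) + g n = S n + g (n + q) := by
    intro n
    have h1 := Finset.sum_range_succ (fun i => g (n + i)) q
    have h2 := Finset.sum_range_succ' (fun i => g (n + i)) q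
    have h3 : ∑ i ∈ Finset.range q, g (n + (i + 1)) = S (n + 1) :=
      Finset.sum_congr rfl fun i _ => by congr 1; ring
    simp only [h3, add_zero] at h2
    exact h2.symm.trans h1
  have hmono : Monotone S := monotone_nat_of_le_succ fun n => by
    have := hS n; have := h n; omega
  have hbdd : BddAbove (Set.range S) := ⟨q * c, by
    rintro _ ⟨n, rfl⟩
    simpa using Finset.sum_le_card_nsmul (Finset.range q) (fun i => g (n + i)) c fun i _ => hc _⟩
  obtain ⟨M, hM⟩ := Nat.sSup_mem (Set.range_nonempty S) hbdd
  refine ⟨M, fun n hn => ?_⟩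
  have h1 : S (n + 1) ≤ S M := hM ▸ le_csSup hbdd ⟨n + 1, rfl⟩
  have h2 := hmono hn
  have := hS n; have := h n
  omega

variable {K}

theorem exists_regular_of_graded_prime {R B : Type*} [Ring R] [Algebra K R]
    [Ring B] [Algebra K B] [FiniteDimensional K B] (G : ℕ → Submodule K R)
    (hmul : ∀ n m a b, a ∈ G n → b ∈ G m → a * b ∈ G (n + m)) (hone : 1 ∈ G 0)
    (π : R →ₐ[K] B) (hinj : ∀ n, ∀ a ∈ G n, π a = 0 → a = 0)
    (hprime : ∀ n m a b, a ∈ G n → b ∈ G m → a ≠ 0 → b ≠ 0 → ∃ k, ∃ x ∈ G k, a * x * b ≠ 0)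
    (hpos : ∃ k, 1 ≤ k ∧ ∃ z ∈ G k, z ≠ 0) :
    ∃ q, 1 ≤ q ∧ ∃ s ∈ G q, ∀ n, ∀ a ∈ G n, s * a = 0 → a = 0 := by
  have hpow : ∀ n a k, a ∈ G n → a ^ k ∈ G (k * n) := by
    intro n a k ha
    induction k with
    | zero => simpa using hone
    | succ k ih => rw [pow_succ, add_mul, one_mul]; exact hmul _ _ _ _ ih ha
  let ker : R → Submodule K B := fun a => LinearMap.ker (LinearMap.mulLeft K (π a))
  have hker : ∀ a v, v ∈ ker a ↔ π a * v = 0 := fun a v => by simp [ker]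
  let ran : R → Submodule K B := fun a => LinearMap.range (LinearMap.mulLeft K (π a))
  have hran : ∀ a v, v ∈ ran a ↔ ∃ w, π a * w = v := fun a v => by simp [ran]
  let good : R → Prop := fun s => (∃ q, 1 ≤ q ∧ s ∈ G q) ∧ ∀ v, π s * (π s * v) = 0 → π s * v = 0
  have hgoodpow : ∀ s, good s → ∀ k v, π s ^ (k + 1) * v = 0 → π s * v = 0 := by
    intro s hs k
    induction k with
    | zero => intro v hv; simpa using hv
    | succ k ih =>
      intro v hv
      refine hs.2 v (ih _ ?_)
      rw [← mul_assoc, ← pow_succ, hv]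
  obtain ⟨s, hs, hmin⟩ : ∃ s, good s ∧ ∀ s', good s' →
      Module.finrank K (ker s) ≤ Module.finrank K (ker s') := by
    have hne : {s | good s}.Nonempty := ⟨0, ⟨1, le_rfl, zero_mem _⟩, by simp⟩
    obtain ⟨s, hs, h⟩ := (measure fun s => Module.finrank K (ker s)).wf.has_min _ hne
    exact ⟨s, hs, fun s' hs' => not_lt.1 (h s' hs')⟩
  obtain ⟨q, hq, hsq⟩ := hs.1
  refine ⟨q, hq, s, hsq, ?_⟩
  by_contra hcon
  push Not at hcon
  obtain ⟨c, ⟨⟨n, hcn⟩, hsc, hc0⟩, hcmin⟩ :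
      ∃ c, ((∃ n, c ∈ G n) ∧ s * c = 0 ∧ c ≠ 0) ∧
        ∀ c', ((∃ n, c' ∈ G n) ∧ s * c' = 0 ∧ c' ≠ 0) →
          Module.finrank K (ran c) ≤ Module.finrank K (ran c') := by
    have hne : {c | (∃ n, c ∈ G n) ∧ s * c = 0 ∧ c ≠ 0}.Nonempty := by
      obtain ⟨n, a, ha, h1, h2⟩ := hcon
      exact ⟨a, ⟨n, ha⟩, h1, h2⟩
    obtain ⟨c, hc, h⟩ := (measure fun c => Module.finrank K (ran c)).wf.has_min _ hne
    exact ⟨c, hc, fun c' hc' => not_lt.1 (h c' hc')⟩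
  obtain ⟨k, hk, z, hz, hz0⟩ := hpos
  obtain ⟨i, u, hu, hcuz⟩ := hprime _ _ c z hcn hz hc0 hz0
  obtain ⟨j, v, hv, hcv⟩ := hprime _ _ (c * u * z) c (hmul _ _ _ _ (hmul _ _ _ _ hcn hu) hz) hcn
    hcuz hc0
  let d := c * u * z * v
  let p := n + i + k + j
  have hdp : d ∈ G p := hmul _ _ _ _ (hmul _ _ _ _ (hmul _ _ _ _ hcn hu) hz) hv
  have hp : 1 ≤ p := by simp only [p]; omega
  have hd : d = c * (u * z * v) := by simp [d, mul_assoc]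
  have hsd : s * d = 0 := by rw [hd, ← mul_assoc, hsc, zero_mul]
  have hdc : Module.finrank K (ran c) ≤ Module.finrank K (ran (d * c)) :=
    hcmin _ ⟨⟨_, hmul _ _ _ _ hdp hcn⟩, by rw [← mul_assoc, hsd, zero_mul], hcv⟩
  have hinjc : ∀ v ∈ ran c, π d * v = 0 → v = 0 := by
    let φ := (LinearMap.mulLeft K (π d)).domRestrict (ran c)
    have h1 : LinearMap.range φ = ran (d * c) := by
      ext w
      simp [φ, hran, mul_assoc]
    have h2 := LinearMap.finrank_range_add_finrank_ker φ
    rw [h1] at h2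
    have h3 : Module.finrank K (LinearMap.ker φ) = 0 := by omega
    rw [Submodule.finrank_eq_zero] at h3
    intro v hv h
    have : (⟨v, hv⟩ : ran c) ∈ LinearMap.ker φ := by simpa [φ] using h
    rw [h3, Submodule.mem_bot] at this
    simpa using this
  have hdgood : good d := by
    refine ⟨⟨p, hp, hdp⟩, fun w h => hinjc _ ?_ h⟩
    rw [hran, hd]
    exact ⟨π (u * z * v) * w, by simp only [map_mul, mul_assoc]⟩
  have hsd' : π s * π d = 0 := by rw [← map_mul, hsd, map_zero]
  obtain ⟨p', hp'⟩ : ∃ p', p = p' + 1 := ⟨p - 1, by omega⟩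
  obtain ⟨q', hq'⟩ : ∃ q', q = q' + 1 := ⟨q - 1, by omega⟩
  let t := s ^ p + d ^ q
  have ht : ∀ w, π t * w = π s ^ p * w + π d ^ q * w := fun w => by simp [t, add_mul]
  have hst : ∀ w, π s * (π t * w) = π s ^ (p + 1) * w := by
    intro w
    rw [ht, mul_add, ← mul_assoc, ← mul_assoc, ← pow_succ', hq', pow_succ' (π d), ← mul_assoc,
      hsd', zero_mul, zero_mul, add_zero]
  have hsker : ∀ w, π t * w = 0 → π s * w = 0 := fun w hw =>
    hgoodpow s hs p w (by rw [← hst, hw, mul_zero])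
  have hspow : ∀ w, π s * w = 0 → π s ^ p * w = 0 := fun w hw => by
    rw [hp', pow_succ, mul_assoc, hw, mul_zero]
  have hdpow : ∀ w, π d * w = 0 → π d ^ q * w = 0 := fun w hw => by
    rw [hq', pow_succ, mul_assoc, hw, mul_zero]
  have hdker : ∀ w, π t * w = 0 → π d * w = 0 := fun w hw =>
    hgoodpow d hdgood q' w (by
      rw [← hq']
      simpa only [hw, hspow w (hsker w hw), zero_add] using (ht w).symm)
  have htgood : good t := by
    refine ⟨⟨p * q, Nat.mul_pos hp hq, add_mem (hpow _ _ _ hsq) ?_⟩, fun w hw => ?_⟩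
    · rw [mul_comm]
      exact hpow _ _ _ hdp
    · have h1 : π s * w = 0 := hgoodpow s hs p w (by rw [← hst]; exact hsker _ hw)
      have h2 : π d ^ (q + 1) * w = 0 := by
        have := hdker _ hw
        rwa [ht, hspow w h1, zero_add, ← mul_assoc, ← pow_succ'] at this
      rw [ht, hspow w h1, hdpow w (hgoodpow d hdgood q w h2), add_zero]
  have hlt : ker t < ker s := by
    refine lt_of_le_of_ne (fun w hw => (hker _ _).2 (hsker w ((hker _ _).1 hw))) fun heq => ?_
    have h1 : π d ∈ ker t := heq ▸ (hker _ _).2 hsd'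
    have h2 : π d * 1 = 0 := hdgood.2 1 (by rw [mul_one]; exact hdker _ ((hker _ _).1 h1))
    rw [mul_one] at h2
    have h3 : d = 0 := hinj _ _ hdp h2
    exact hcv (by change d * c = 0; rw [h3, zero_mul])
  exact absurd (hmin t htgood) (not_le.2 (Submodule.finrank_lt_finrank_of_lt hlt))

/-- A graded algebra that maps to a finite-dimensional algebra injectively on each homogeneous
component and is prime on homogeneous elements is left Noetherian. -/
theorem isNoetherianRing_of_graded_prime {R B : Type*} [Ring R] [Algebra K R]
    [Ring B] [Algebra K B] [FiniteDimensional K B] (G : ℕ → Submodule K R)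
    (hmul : ∀ n m a b, a ∈ G n → b ∈ G m → a * b ∈ G (n + m)) (hone : 1 ∈ G 0)
    (htop : ⨆ n, G n = ⊤)
    (π : R →ₐ[K] B) (hinj : ∀ n, ∀ a ∈ G n, π a = 0 → a = 0)
    (hprime : ∀ n m a b, a ∈ G n → b ∈ G m → a ≠ 0 → b ≠ 0 → ∃ k, ∃ x ∈ G k, a * x * b ≠ 0)
    (hpos : ∃ k, 1 ≤ k ∧ ∃ z ∈ G k, z ≠ 0) : IsNoetherianRing R := by
  obtain ⟨q, hq, s, hs, hreg⟩ := exists_regular_of_graded_prime G hmul hone π hinj hprime hpos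
  have hπ : ∀ n, Function.Injective (π.toLinearMap.domRestrict (G n)) := by
    intro n
    rw [injective_iff_map_eq_zero]
    intro a ha
    exact Subtype.ext (hinj n a a.2 ha)
  have : ∀ n, FiniteDimensional K (G n) := fun n => FiniteDimensional.of_injective _ (hπ n)
  let φ : ∀ n, G n →ₗ[K] G (n + q) := fun n =>
    (LinearMap.mulLeft K s).restrict fun a ha => by
      rw [add_comm]; exact hmul _ _ _ _ hs ha
  have hφ : ∀ n, Function.Injective (φ n) := by
    intro n
    rw [injective_iff_map_eq_zero]
    intro a ha
    exact Subtype.ext (hreg n a a.2 (congrArg Subtype.val ha))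
  obtain ⟨M, hM⟩ := exists_forall_eq_add_of_bounded (fun n => Module.finrank K (G n)) q
    (Module.finrank K B) (fun n => LinearMap.finrank_le_finrank_of_injective (hφ n))
    (fun n => LinearMap.finrank_le_finrank_of_injective (hπ n))
  refine isNoetherianRing_of_mul_surjective K G (fun n => ?_) htop s q M hq fun n hn a ha => ?_
  · exact (Submodule.fg_top _).1 Module.Finite.fg_top
  · obtain ⟨b, hb⟩ := (LinearMap.injective_iff_surjective_of_finrank_eq_finrank
      (hM n hn).symm).1 (hφ n) ⟨a, ha⟩
    exact ⟨b, b.2, congrArg Subtype.val hb⟩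

end GradedNoetherian

section Words

/-- The monomial of the free algebra attached to a word. -/
def word {X : Type*} (w : List X) : FreeAlgebra K X :=
  (w.map (FreeAlgebra.ι K)).prod

/-- The monomials form a basis of the free algebra. -/
def wordBasis (X : Type*) : Module.Basis (List X) K (FreeAlgebra K X) :=
  (FreeAlgebra.basisFreeMonoid K X).reindex FreeMonoid.toList

/-- The bilinear form on the free algebra for which the monomials are orthonormal. -/
def wordPairing (X : Type*) : FreeAlgebra K X →ₗ[K] FreeAlgebra K X →ₗ[K] K :=
  (wordBasis K X).toDual

/-- The projection onto the component of degree `n`. -/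
def homogComp (n : ℕ) : FA K →ₗ[K] FA K :=
  (wordBasis K (Fin 2)).constr K fun w => if w.length = n then word K w else 0

@[simp]
theorem wordBasis_apply {X : Type*} (w : List X) : wordBasis K X w = word K w := by
  simp only [wordBasis, Module.Basis.reindex_apply, FreeAlgebra.basisFreeMonoid,
    Module.Basis.map_apply]
  change FreeAlgebra.equivMonoidAlgebraFreeMonoid.symm
    ((MonoidAlgebra.coeffLinearEquiv K).symm (Finsupp.basisSingleOne (FreeMonoid.ofList w))) = _
  rw [AlgEquiv.symm_apply_eq]
  have key : ∀ v : List X, FreeAlgebra.equivMonoidAlgebraFreeMonoid (word K v) =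
      MonoidAlgebra.of K _ (FreeMonoid.ofList v) := by
    intro v
    induction v with
    | nil => simp [word, MonoidAlgebra.one_def]
    | cons x v ih =>
      rw [FreeMonoid.ofList_cons, map_mul, ← ih]
      simp [word, FreeAlgebra.equivMonoidAlgebraFreeMonoid]
  rw [key]
  rfl

variable {K}

section General
variable {X : Type*}

theorem word_append (u v : List X) : word K (u ++ v) = word K u * word K v := by
  simp [word]

@[simp]
theorem word_nil : word K ([] : List X) = 1 := rfl

theorem span_range_word : Submodule.span K (Set.range (word K (X := X))) = ⊤ := by
  rw [← (wordBasis K X).span_eq]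
  congr 2
  ext w
  rw [wordBasis_apply]

theorem word_induction {p : FreeAlgebra K X → Prop} (hw : ∀ w, p (word K w))
    (h0 : p 0) (hadd : ∀ a b, p a → p b → p (a + b)) (hsmul : ∀ (c : K) a, p a → p (c • a))
    (a : FreeAlgebra K X) : p a := by
  have ha : a ∈ Submodule.span K (Set.range (word K (X := X))) := by
    rw [span_range_word]; trivial
  induction ha using Submodule.span_induction with
  | mem x hx => obtain ⟨w, rfl⟩ := hx; exact hw w
  | zero => exact h0
  | add x y _ _ hx hy => exact hadd _ _ hx hy
  | smul c x _ hx => exact hsmul _ _ hx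

theorem wordPairing_word (u v : List X) :
    wordPairing K X (word K u) (word K v) = if u = v then 1 else 0 := by
  rw [← wordBasis_apply, ← wordBasis_apply]
  exact (wordBasis K X).toDual_apply u v

theorem eq_zero_of_wordPairing {a : FreeAlgebra K X}
    (h : ∀ w, wordPairing K X a (word K w) = 0) : a = 0 := by
  refine (wordBasis K X).toDual_inj a ((wordBasis K X).ext fun w => ?_)
  rw [wordBasis_apply]
  exact h w

end General

local notation "⟪" a "," b "⟫" => wordPairing K (Fin 2) a b

theorem word_mem_Adeg (w : List (Fin 2)) : word K w ∈ Adeg K w.length :=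
  Submodule.subset_span ⟨w, rfl, rfl⟩

theorem word_mem_Adeg' {w : List (Fin 2)} {n : ℕ} (h : w.length = n) : word K w ∈ Adeg K n :=
  h ▸ word_mem_Adeg w

@[elab_as_elim]
theorem Adeg_induction {n : ℕ} {p : ∀ a, a ∈ Adeg K n → Prop}
    (hw : ∀ w (h : w.length = n), p (word K w) (word_mem_Adeg' h))
    (h0 : p 0 (zero_mem _)) (hadd : ∀ a b ha hb, p a ha → p b hb → p (a + b) (add_mem ha hb))
    (hsmul : ∀ (c : K) a ha, p a ha → p (c • a) (Submodule.smul_mem _ c ha))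
    {a : FA K} (ha : a ∈ Adeg K n) : p a ha := by
  induction ha using Submodule.span_induction with
  | mem x hx => obtain ⟨w, hl, rfl⟩ := hx; exact hw w hl
  | zero => exact h0
  | add x y _ _ hx hy => exact hadd _ _ _ _ hx hy
  | smul c x _ hx => exact hsmul _ _ _ hx

theorem mul_mem_Adeg {n m : ℕ} {a b : FA K} (ha : a ∈ Adeg K n) (hb : b ∈ Adeg K m) :
    a * b ∈ Adeg K (n + m) := by
  induction ha using Adeg_induction with
  | hw u hu =>
    induction hb using Adeg_induction with
    | hw v hv => rw [← word_append]; exact word_mem_Adeg' (by simp [hu, hv])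
    | h0 => simp
    | hadd a b _ _ ha hb => rw [mul_add]; exact add_mem ha hb
    | hsmul c a _ ha => rw [mul_smul_comm]; exact Submodule.smul_mem _ _ ha
  | h0 => simp
  | hadd a b _ _ ha hb => rw [add_mul]; exact add_mem ha hb
  | hsmul c a _ ha => rw [smul_mul_assoc]; exact Submodule.smul_mem _ _ ha

theorem Adeg_mul (n m : ℕ) : Adeg K n * Adeg K m = Adeg K (n + m) := by
  refine le_antisymm (Submodule.mul_le.2 fun a ha b hb => mul_mem_Adeg ha hb) fun a ha => ?_
  induction ha using Adeg_induction with
  | hw w hw =>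
    rw [← List.take_append_drop n w, word_append]
    exact Submodule.mul_mem_mul (word_mem_Adeg' (by simp; omega)) (word_mem_Adeg' (by simp; omega))
  | h0 => exact zero_mem _
  | hadd a b _ _ ha hb => exact add_mem ha hb
  | hsmul c a _ ha => exact Submodule.smul_mem _ _ ha

theorem one_mem_Adeg : (1 : FA K) ∈ Adeg K 0 := word_mem_Adeg' (w := []) rfl

theorem pow_le_Adeg {D : Submodule K (FA K)} {L : ℕ} (hD : D ≤ Adeg K L) (k : ℕ) :
    D ^ k ≤ Adeg K (L * k) := by
  induction k with
  | zero => simpa [Submodule.one_le] using one_mem_Adeg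
  | succ k ih =>
    rw [pow_succ, Nat.mul_succ, ← Adeg_mul]
    exact mul_le_mul' ih hD

instance (n : ℕ) : FiniteDimensional K (Adeg K n) := by
  refine FiniteDimensional.span_of_finite K
    (((List.finite_length_eq (Fin 2) n).image (word K)).subset ?_)
  rintro _ ⟨w, hw, rfl⟩
  exact ⟨w, hw, rfl⟩

theorem finiteDimensional_of_le_Adeg {D : Submodule K (FA K)} {n : ℕ} (h : D ≤ Adeg K n) :
    FiniteDimensional K D :=
  Submodule.finiteDimensional_of_le h

theorem wordPairing_of_ne {n m : ℕ} (h : n ≠ m) {a b : FA K} (ha : a ∈ Adeg K n)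
    (hb : b ∈ Adeg K m) : ⟪a, b⟫ = 0 := by
  induction ha using Adeg_induction with
  | hw u hu =>
    induction hb using Adeg_induction with
    | hw v hv =>
      rw [wordPairing_word, if_neg]
      rintro rfl
      omega
    | h0 => simp
    | hadd a b _ _ ha hb => simp [ha, hb]
    | hsmul c a _ ha => simp [ha]
  | h0 => simp
  | hadd a b _ _ ha hb => simp [ha, hb]
  | hsmul c a _ ha => simp [ha]

theorem wordPairing_mul_mul {n : ℕ} {g u : FA K} (hg : g ∈ Adeg K n) (hu : u ∈ Adeg K n)
    (h v : FA K) : ⟪g * h, u * v⟫ = ⟪g, u⟫ * ⟪h, v⟫ := by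
  induction hg using Adeg_induction with
  | hw w hw =>
    induction hu using Adeg_induction with
    | hw w' hw' =>
      induction h using word_induction with
      | hw x =>
        induction v using word_induction with
        | hw y =>
          simp only [← word_append, wordPairing_word]
          have : w ++ x = w' ++ y ↔ w = w' ∧ x = y :=
            ⟨fun h => List.append_inj h (by omega), by rintro ⟨rfl, rfl⟩; rfl⟩
          by_cases h1 : w = w' <;> by_cases h2 : x = y <;> simp [this, h1, h2]
        | h0 => simp
        | hadd a b ha hb => simp [mul_add, ha, hb]
        | hsmul c a ha => simp [ha]; ring
      | h0 => simp
      | hadd a b ha hb => simp [mul_add, ha, hb]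
      | hsmul c a ha => simp [ha]; ring
    | h0 => simp
    | hadd a b _ _ ha hb => simp [add_mul, ha, hb]
    | hsmul c a _ ha => simp [ha, mul_assoc]
  | h0 => simp
  | hadd a b _ _ ha hb => simp [add_mul, ha, hb]
  | hsmul c a _ ha => simp [ha, mul_assoc]

theorem wordPairing_mul_mul' {n : ℕ} (g u : FA K) {h v : FA K} (hh : h ∈ Adeg K n)
    (hv : v ∈ Adeg K n) : ⟪g * h, u * v⟫ = ⟪g, u⟫ * ⟪h, v⟫ := by
  induction g using word_induction with
  | hw w =>
    induction u using word_induction with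
    | hw w' =>
      by_cases hl : w.length = w'.length
      · exact wordPairing_mul_mul (word_mem_Adeg w) (word_mem_Adeg' hl.symm) _ _
      · rw [wordPairing_of_ne (by omega) (mul_mem_Adeg (word_mem_Adeg w) hh)
          (mul_mem_Adeg (word_mem_Adeg w') hv),
          wordPairing_of_ne hl (word_mem_Adeg w) (word_mem_Adeg w'), zero_mul]
    | h0 => simp
    | hadd a b ha hb => simp [add_mul, ha, hb]
    | hsmul c a ha => simp [ha, mul_assoc]
  | h0 => simp
  | hadd a b ha hb => simp [add_mul, ha, hb]
  | hsmul c a ha => simp [ha, mul_assoc]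

theorem exists_word_wordPairing_ne_zero {n : ℕ} {a : FA K} (ha : a ∈ Adeg K n) (h : a ≠ 0) :
    ∃ w : List (Fin 2), w.length = n ∧ ⟪a, word K w⟫ ≠ 0 := by
  by_contra! hcon
  refine h (eq_zero_of_wordPairing fun w => ?_)
  by_cases hw : w.length = n
  · exact hcon w hw
  · exact wordPairing_of_ne (Ne.symm hw) ha (word_mem_Adeg w)

@[simp]
theorem homogComp_word (n : ℕ) (w : List (Fin 2)) :
    homogComp K n (word K w) = if w.length = n then word K w else 0 := by
  rw [homogComp, ← wordBasis_apply, Module.Basis.constr_basis, wordBasis_apply]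

theorem homogComp_mem (n : ℕ) (a : FA K) : homogComp K n a ∈ Adeg K n := by
  induction a using word_induction with
  | hw w =>
    rw [homogComp_word]
    split_ifs with h
    · exact word_mem_Adeg' h
    · exact zero_mem _
  | h0 => simp
  | hadd a b ha hb => rw [map_add]; exact add_mem ha hb
  | hsmul c a ha => rw [map_smul]; exact Submodule.smul_mem _ _ ha

theorem homogComp_of_mem {n : ℕ} {a : FA K} (ha : a ∈ Adeg K n) : homogComp K n a = a := by
  induction ha using Adeg_induction with
  | hw w hw => rw [homogComp_word, if_pos hw]
  | h0 => simp
  | hadd a b _ _ ha hb => rw [map_add, ha, hb]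
  | hsmul c a _ ha => rw [map_smul, ha]

theorem exists_sum_homogComp (a : FA K) :
    ∃ N, ∀ M, N ≤ M → a = ∑ n ∈ Finset.range M, homogComp K n a := by
  induction a using word_induction with
  | hw w =>
    refine ⟨w.length + 1, fun M hM => ?_⟩
    simp only [homogComp_word]
    rw [Finset.sum_ite_eq, if_pos (Finset.mem_range.2 (by omega))]
  | h0 => exact ⟨0, by simp⟩
  | hadd a b ha hb =>
    obtain ⟨N, hN⟩ := ha
    obtain ⟨N', hN'⟩ := hb
    refine ⟨max N N', fun M hM => ?_⟩
    simp only [map_add, Finset.sum_add_distrib]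
    rw [← hN M (le_trans (le_max_left _ _) hM), ← hN' M (le_trans (le_max_right _ _) hM)]
  | hsmul c a ha =>
    obtain ⟨N, hN⟩ := ha
    refine ⟨N, fun M hM => ?_⟩
    simp only [map_smul, ← Finset.smul_sum]
    rw [← hN M hM]

theorem wordPairing_homogComp {n : ℕ} {g : FA K} (hg : g ∈ Adeg K n) (a : FA K) :
    ⟪g, homogComp K n a⟫ = ⟪g, a⟫ := by
  induction a using word_induction with
  | hw w =>
    rw [homogComp_word]
    split_ifs with h
    · rfl
    · rw [map_zero, wordPairing_of_ne (Ne.symm h) hg (word_mem_Adeg w)]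
  | h0 => simp
  | hadd a b ha hb => simp only [map_add, ha, hb]
  | hsmul c a ha => simp only [map_smul, ha]

end Words

section LinearAlgebra

variable {K}
variable {V W U : Type*} [AddCommGroup V] [Module K V] [AddCommGroup W] [Module K W]
  [AddCommGroup U] [Module K U]

theorem finiteDimensional_map₂ (B : V →ₗ[K] W →ₗ[K] U) (S : Submodule K V) (T : Submodule K W)
    [FiniteDimensional K S] [FiniteDimensional K T] :
    FiniteDimensional K (Submodule.map₂ B S T) := by
  rw [TensorProduct.map₂_eq_range_lift_comp_mapIncl]
  infer_instance

theorem finrank_map₂_le (B : V →ₗ[K] W →ₗ[K] U) (S : Submodule K V) (T : Submodule K W)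
    [FiniteDimensional K S] [FiniteDimensional K T] :
    Module.finrank K (Submodule.map₂ B S T) ≤ Module.finrank K S * Module.finrank K T := by
  rw [TensorProduct.map₂_eq_range_lift_comp_mapIncl]
  exact (LinearMap.finrank_range_le _).trans (Module.finrank_tensorProduct).le

theorem finrank_finset_sup_le {ι : Type*} (s : Finset ι) (F : ι → Submodule K V) (c : ℕ)
    (hfin : ∀ i ∈ s, FiniteDimensional K (F i)) (hc : ∀ i ∈ s, Module.finrank K (F i) ≤ c) :
    FiniteDimensional K (s.sup F : Submodule K V) ∧
      Module.finrank K (s.sup F : Submodule K V) ≤ s.card * c := by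
  induction s using Finset.induction_on with
  | empty => rw [Finset.sup_empty]; exact ⟨inferInstance, by simp⟩
  | insert a s ha ih =>
    obtain ⟨h1, h2⟩ := ih (fun i hi => hfin i (Finset.mem_insert_of_mem hi))
      (fun i hi => hc i (Finset.mem_insert_of_mem hi))
    have h3 := hfin a (Finset.mem_insert_self a s)
    have h4 := hc a (Finset.mem_insert_self a s)
    rw [Finset.sup_insert, Finset.card_insert_of_notMem ha]
    refine ⟨inferInstance, (Submodule.finrank_add_le_finrank_add_finrank _ _).trans ?_⟩
    rw [add_mul, one_mul]
    omega

theorem finrank_le_finrank_inf_dualCoannihilator_add (Q : Submodule K V) [FiniteDimensional K Q]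
    (Φ : Submodule K (Module.Dual K V)) [FiniteDimensional K Φ] :
    Module.finrank K Q ≤
      Module.finrank K (Q ⊓ Φ.dualCoannihilator : Submodule K V) + Module.finrank K Φ := by
  let Ψ : Submodule K (Module.Dual K Q) := Φ.map Q.subtype.dualMap
  have h1 := Subspace.finrank_add_finrank_dualCoannihilator_eq Ψ
  have h2 : Module.finrank K Ψ ≤ Module.finrank K Φ := Submodule.finrank_map_le _ _
  have h3 : Ψ.dualCoannihilator.map Q.subtype = Q ⊓ Φ.dualCoannihilator := by
    ext x
    simp only [Submodule.mem_map, Submodule.mem_inf, Submodule.mem_dualCoannihilator, Ψ]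
    constructor
    · rintro ⟨y, hy, rfl⟩
      exact ⟨y.2, fun φ hφ => hy _ ⟨φ, hφ, rfl⟩⟩
    · rintro ⟨hx, h⟩
      refine ⟨⟨x, hx⟩, ?_, rfl⟩
      rintro _ ⟨φ, hφ, rfl⟩
      exact h φ hφ
  have h4 : Module.finrank K (Ψ.dualCoannihilator.map Q.subtype) =
      Module.finrank K Ψ.dualCoannihilator := 
    (Submodule.equivMapOfInjective _ Q.injective_subtype _).finrank_eq.symm
  rw [← h3, h4]
  omega

theorem exists_fin_le_span_range (T : Submodule K V) [FiniteDimensional K T] :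
    ∃ b : Fin (Module.finrank K T) → V, (∀ i, b i ∈ T) ∧ T ≤ Submodule.span K (Set.range b) := by
  let b := Module.finBasis K T
  refine ⟨fun i => b i, fun i => (b i).2, fun t ht => ?_⟩
  have := congrArg Subtype.val (b.sum_repr ⟨t, ht⟩)
  rw [← show _ = t from this]
  simp only [AddSubmonoidClass.coe_finsetSum, Submodule.coe_smul]
  exact Submodule.sum_mem _ fun i _ => Submodule.smul_mem _ _ (Submodule.subset_span ⟨i, rfl⟩)

theorem exists_mem_common_isotropic [IsAlgClosed K] (Q : Submodule K V) [FiniteDimensional K Q]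
    (β : V →ₗ[K] V →ₗ[K] U)
    (T : Submodule K (Module.Dual K U)) [FiniteDimensional K T]
    (h : Module.finrank K T < Module.finrank K Q) :
    ∃ g ∈ Q, g ≠ 0 ∧ ∀ t ∈ T, t (β g g) = 0 := by
  obtain ⟨b, -, hb⟩ := exists_fin_le_span_range T
  obtain ⟨g, hg, h0⟩ := exists_ne_zero_common_isotropic (Q := Q)
    (fun i => (β.compr₂ (b i)).compl₁₂ Q.subtype Q.subtype) (by simpa using h)
  refine ⟨g, g.2, by simpa using hg, fun t ht => ?_⟩
  have hle : Submodule.span K (Set.range b) ≤ LinearMap.ker (Module.Dual.eval K U (β g g)) := by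
    rw [Submodule.span_le]
    rintro _ ⟨i, rfl⟩
    exact h0 i
  exact hle (hb ht)

/-- A space of dimension at least `3 c + 2` contains a plane on which all members of a
`c`-dimensional space of bilinear forms factoring through `β` vanish. -/
theorem exists_isotropic_plane [IsAlgClosed K] (Q : Submodule K V) [FiniteDimensional K Q]
    (β : V →ₗ[K] V →ₗ[K] U)
    (T : Submodule K (Module.Dual K U)) [FiniteDimensional K T]
    (h : 3 * Module.finrank K T + 2 ≤ Module.finrank K Q) :
    ∃ D ≤ Q, Module.finrank K D = 2 ∧ ∀ t ∈ T, ∀ g ∈ D, ∀ g' ∈ D, t (β g g') = 0 := by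
  obtain ⟨g₁, hg₁, hne, h11⟩ := exists_mem_common_isotropic Q β T (by omega)
  obtain ⟨l, hl⟩ : ∃ l : Module.Dual K V, l g₁ ≠ 0 := by
    by_contra! hcon
    exact hne ((Module.forall_dual_apply_eq_zero_iff K g₁).1 hcon)
  let Φ₁ : Submodule K (Module.Dual K V) := T.map (β g₁).dualMap
  let Φ₂ : Submodule K (Module.Dual K V) :=
    T.map (β.flip g₁).dualMap
  let Φ : Submodule K (Module.Dual K V) := (Φ₁ ⊔ Φ₂) ⊔ Submodule.span K {l}
  have hΦ : Module.finrank K Φ ≤ 2 * Module.finrank K T + 1 := by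
    have h1 : Module.finrank K Φ₁ ≤ Module.finrank K T := Submodule.finrank_map_le _ _
    have h2 : Module.finrank K Φ₂ ≤ Module.finrank K T := Submodule.finrank_map_le _ _
    have h3 := Submodule.finrank_add_le_finrank_add_finrank Φ₁ Φ₂
    have h4 := Submodule.finrank_add_le_finrank_add_finrank (Φ₁ ⊔ Φ₂) (Submodule.span K {l})
    have h5 : Module.finrank K (Submodule.span K {l}) ≤ 1 := by
      simpa using finrank_span_le_card (R := K) ({l} : Set (Module.Dual K V))
    have h6 : Module.finrank K Φ = Module.finrank K ((Φ₁ ⊔ Φ₂) ⊔ Submodule.span K {l} :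
      Submodule K (Module.Dual K V)) := rfl
    omega
  have hQ := finrank_le_finrank_inf_dualCoannihilator_add Q Φ
  obtain ⟨g₂, ⟨hg₂, hg₂'⟩, hne₂, h22⟩ :=
    exists_mem_common_isotropic (Q ⊓ Φ.dualCoannihilator) β T (by omega)
  have hz : ∀ φ ∈ Φ, φ g₂ = 0 := (Submodule.mem_dualCoannihilator _).1 hg₂'
  have hl₂ : l g₂ = 0 := hz l (Submodule.mem_sup_right (Submodule.mem_span_singleton_self l))
  have h12 : ∀ t ∈ T, t (β g₁ g₂) = 0 := fun t ht =>
    hz _ (Submodule.mem_sup_left (Submodule.mem_sup_left ⟨t, ht, rfl⟩))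
  have h21 : ∀ t ∈ T, t (β g₂ g₁) = 0 := fun t ht =>
    hz _ (Submodule.mem_sup_left (Submodule.mem_sup_right ⟨t, ht, rfl⟩))
  have hli : LinearIndependent K ![g₁, g₂] := by
    rw [LinearIndependent.pair_iff]
    intro a b hab
    have ha : a = 0 := by
      have := congrArg l hab
      simpa [hl₂, hl] using this
    subst ha
    simpa [hne₂] using hab
  refine ⟨Submodule.span K (Set.range ![g₁, g₂]), ?_, ?_, ?_⟩
  · rw [Submodule.span_le]
    rintro _ ⟨i, rfl⟩
    fin_cases i
    exacts [hg₁, hg₂]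
  · simpa using finrank_span_eq_card hli
  · intro t ht g hg g' hg'
    rw [Matrix.range_cons, Matrix.range_cons, Matrix.range_empty, Set.union_empty,
      Set.singleton_union, Submodule.mem_span_pair] at hg hg'
    obtain ⟨a, b, rfl⟩ := hg
    obtain ⟨a', b', rfl⟩ := hg'
    simp [h11 t ht, h12 t ht, h21 t ht, h22 t ht]

/-- Modulo the vectors orthogonal to a finite-dimensional `P`, a subspace `A` is represented by a
subspace of dimension at most `dim P`. -/
theorem exists_representatives (B : V →ₗ[K] W →ₗ[K] K) (P : Submodule K V) [FiniteDimensional K P]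
    (A : Submodule K W) :
    ∃ A₀ ≤ A, FiniteDimensional K A₀ ∧ Module.finrank K A₀ ≤ Module.finrank K P ∧
      ∀ u ∈ A, ∃ u₀ ∈ A₀, ∀ p ∈ P, B p u = B p u₀ := by
  let φ : A →ₗ[K] Module.Dual K P := (B.flip.compl₁₂ A.subtype P.subtype)
  obtain ⟨C, hC⟩ := Submodule.exists_isCompl (LinearMap.ker φ)
  have hinj : Function.Injective (φ.domRestrict C) := by
    rw [injective_iff_map_eq_zero]
    intro x hx
    exact Subtype.ext ((Submodule.disjoint_def.1 hC.disjoint) x hx x.2)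
  have hfin : FiniteDimensional K C := FiniteDimensional.of_injective _ hinj
  refine ⟨C.map A.subtype, ?_, inferInstance, ?_, fun u hu => ?_⟩
  · rintro _ ⟨x, -, rfl⟩
    exact x.2
  · refine (Submodule.finrank_map_le _ _).trans ?_
    rw [← Subspace.dual_finrank_eq (V := P)]
    exact LinearMap.finrank_le_finrank_of_injective hinj
  · have hmem : (⟨u, hu⟩ : A) ∈ LinearMap.ker φ ⊔ C := hC.sup_eq_top ▸ Submodule.mem_top
    obtain ⟨y, hy, z, hz, hyz⟩ := Submodule.mem_sup.1 hmem
    refine ⟨z, ⟨z, hz, rfl⟩, fun p hp => ?_⟩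
    have h1 : B p y = 0 := LinearMap.congr_fun (LinearMap.mem_ker.1 hy) ⟨p, hp⟩
    have h2 : (y : W) + z = u := congrArg Subtype.val hyz
    rw [← h2, map_add, h1, zero_add]

end LinearAlgebra

section Thin

local notation "⟪" a "," b "⟫" => wordPairing K (Fin 2) a b

variable {K}

theorem finrank_mul_le (S T : Submodule K (FA K)) [FiniteDimensional K S] [FiniteDimensional K T] :
    Module.finrank K (S * T : Submodule K (FA K)) ≤ Module.finrank K S * Module.finrank K T := by
  rw [Submodule.mul_eq_map₂]
  exact finrank_map₂_le (LinearMap.mul K (FA K)) S T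

theorem finiteDimensional_pow {D : Submodule K (FA K)} {L : ℕ} (hD : D ≤ Adeg K L) (k : ℕ) :
    FiniteDimensional K (D ^ k : Submodule K (FA K)) :=
  finiteDimensional_of_le_Adeg (pow_le_Adeg hD k)

theorem finrank_pow_le {D : Submodule K (FA K)} {L : ℕ} (hD : D ≤ Adeg K L) (k : ℕ) :
    Module.finrank K (D ^ k : Submodule K (FA K)) ≤ Module.finrank K D ^ k := by
  have := finiteDimensional_of_le_Adeg hD
  induction k with
  | zero =>
    rw [pow_zero, pow_zero, Submodule.one_eq_span]
    simpa using finrank_span_le_card (R := K) ({1} : Set (FA K))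
  | succ k ih =>
    have := finiteDimensional_pow hD k
    rw [pow_succ, pow_succ]
    exact (finrank_mul_le _ _).trans (Nat.mul_le_mul_right _ ih)

variable (K) in
/-- `D ⊆ A(L)` is `C`-thin if at every cut of the degree the left and the right factors occurring
in `D` lie in spaces of dimension at most `C`. -/
def Thin (L C : ℕ) (D : Submodule K (FA K)) : Prop :=
  D ≤ Adeg K L ∧ ∀ a b, a + b = L → 0 < b →
    (∃ S ≤ Adeg K a, Module.finrank K S ≤ C ∧ D ≤ Adeg K b * S) ∧
    (∃ P ≤ Adeg K a, Module.finrank K P ≤ C ∧ D ≤ P * Adeg K b)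

theorem Thin.mono {L C C' : ℕ} {D D' : Submodule K (FA K)} (h : Thin K L C D) (hD : D' ≤ D)
    (hC : C ≤ C') : Thin K L C' D' := by
  refine ⟨hD.trans h.1, fun a b hab hb => ?_⟩
  obtain ⟨⟨S, h1, h2, h3⟩, P, h4, h5, h6⟩ := h.2 a b hab hb
  exact ⟨⟨S, h1, h2.trans hC, hD.trans h3⟩, P, h4, h5.trans hC, hD.trans h6⟩

theorem Thin.exists_pow_le {L C h a b : ℕ} {D : Submodule K (FA K)} (hD : Thin K L C D)
    (h2 : Module.finrank K D = 2) (hab : a + b = L * h) (hb : 0 < b) :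
    (∃ S ≤ Adeg K a, Module.finrank K S ≤ C * 2 ^ (a / L) ∧ D ^ h ≤ Adeg K b * S) ∧
    (∃ P ≤ Adeg K a, Module.finrank K P ≤ C * 2 ^ (a / L) ∧ D ^ h ≤ P * Adeg K b) := by
  have hL : 0 < L := by
    rcases Nat.eq_zero_or_pos L with rfl | h
    · omega
    · exact h
  obtain ⟨q, ρ, hρ, rfl⟩ : ∃ q ρ, ρ < L ∧ a = L * q + ρ :=
    ⟨a / L, a % L, Nat.mod_lt _ hL, (Nat.div_add_mod a L).symm⟩
  have hq : q < h := by
    by_contra! hcon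
    have := Nat.mul_le_mul_left L hcon
    omega
  obtain ⟨s, rfl⟩ : ∃ s, h = s + 1 + q := ⟨h - 1 - q, by omega⟩
  obtain ⟨b', rfl⟩ : ∃ b', L = ρ + b' := ⟨L - ρ, by omega⟩
  have hb' : b = (ρ + b') * s + b' := by
    have : (ρ + b') * (s + 1 + q) = (ρ + b') * s + (ρ + b') + (ρ + b') * q := by ring
    omega
  have hdiv : ((ρ + b') * q + ρ) / (ρ + b') = q := by
    rw [Nat.mul_add_div hL, Nat.div_eq_of_lt hρ, add_zero]
  have hDf := finiteDimensional_pow hD.1 q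
  have hrk : Module.finrank K (D ^ q : Submodule K (FA K)) ≤ 2 ^ q := by
    simpa [h2] using finrank_pow_le hD.1 q
  rw [hdiv, hb']
  obtain ⟨⟨S, h1, h2, h3⟩, P, h4, h5, h6⟩ := hD.2 ρ b' rfl (by omega)
  have hSf := finiteDimensional_of_le_Adeg h1
  have hPf := finiteDimensional_of_le_Adeg h4
  refine ⟨⟨S * D ^ q, ?_, (finrank_mul_le _ _).trans (Nat.mul_le_mul h2 hrk), ?_⟩,
    ⟨D ^ q * P, ?_, (finrank_mul_le _ _).trans ?_, ?_⟩⟩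
  · rw [add_comm _ ρ, ← Adeg_mul]
    exact mul_le_mul' h1 (pow_le_Adeg hD.1 q)
  · rw [pow_add, pow_succ, ← Adeg_mul, ← mul_assoc, mul_assoc (Adeg K _)]
    exact mul_le_mul' (mul_le_mul' (pow_le_Adeg hD.1 s) h3) le_rfl
  · rw [← Adeg_mul]
    exact mul_le_mul' (pow_le_Adeg hD.1 q) h4
  · rw [mul_comm]
    exact Nat.mul_le_mul h5 hrk
  · rw [add_comm (s + 1) q, pow_add, pow_succ', add_comm _ b', ← Adeg_mul, mul_assoc,
      ← mul_assoc P]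
    exact mul_le_mul' le_rfl (mul_le_mul' h6 (pow_le_Adeg hD.1 s))

theorem Thin.pow {L C h : ℕ} {D : Submodule K (FA K)} (hD : Thin K L C D)
    (h2 : Module.finrank K D = 2) : Thin K (L * (h + 1)) (C * 2 ^ h) (D ^ (h + 1)) := by
  refine ⟨pow_le_Adeg hD.1 _, fun a b hab hb => ?_⟩
  have hle : C * 2 ^ (a / L) ≤ C * 2 ^ h := by
    refine Nat.mul_le_mul_left _ (Nat.pow_le_pow_right (by norm_num) ?_)
    exact Nat.lt_succ_iff.1 (Nat.div_lt_of_lt_mul (by rw [Nat.succ_eq_add_one]; omega))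
  obtain ⟨⟨S, h1, h2, h3⟩, P, h4, h5, h6⟩ := hD.exists_pow_le h2 hab hb
  exact ⟨⟨S, h1, h2.trans hle, h3⟩, P, h4, h5.trans hle, h6⟩

theorem thin_one : Thin K 1 1 (Adeg K 1) := by
  refine ⟨le_rfl, fun a b hab hb => ?_⟩
  obtain ⟨rfl, rfl⟩ : a = 0 ∧ b = 1 := by omega
  have hr : Module.finrank K (1 : Submodule K (FA K)) ≤ 1 := by
    rw [Submodule.one_eq_span]
    simpa using finrank_span_le_card (R := K) ({1} : Set (FA K))
  have h0 : (1 : Submodule K (FA K)) ≤ Adeg K 0 := Submodule.one_le.2 one_mem_Adeg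
  exact ⟨⟨1, h0, hr, by rw [mul_one]⟩, 1, h0, hr, by rw [one_mul]⟩

theorem finrank_Adeg_one : Module.finrank K (Adeg K 1) = 2 := by
  have h : Adeg K 1 = Submodule.span K (Set.range (FreeAlgebra.ι K : Fin 2 → FA K)) := by
    apply le_antisymm
    · refine Submodule.span_mono ?_
      rintro _ ⟨w, hw, rfl⟩
      obtain ⟨i, rfl⟩ := List.length_eq_one_iff.1 hw
      exact ⟨i, by simp⟩
    · refine Submodule.span_mono ?_
      rintro _ ⟨i, rfl⟩
      exact ⟨[i], rfl, by simp⟩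
  have hli : LinearIndependent K (FreeAlgebra.ι K : Fin 2 → FA K) := by
    have := (wordBasis K (Fin 2)).linearIndependent.comp (fun i => [i])
      (fun i j h => by simpa using h)
    convert this using 1
    ext i
    simp [word]
  rw [h, finrank_span_eq_card hli, Fintype.card_fin]

end Thin

section DualWords

local notation "⟪" a "," b "⟫" => wordPairing K (Fin 2) a b

variable {K}

theorem exists_dual_words {D : Submodule K (FA K)} {L : ℕ} (hD : D ≤ Adeg K L)
    (h2 : Module.finrank K D = 2) :
    ∃ (g : Fin 2 → FA K) (m : Fin 2 → List (Fin 2)), (∀ i, g i ∈ D) ∧ (∀ i, (m i).length = L) ∧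
      ∀ i j, ⟪g i, word K (m j)⟫ = if i = j then 1 else 0 := by
  have := finiteDimensional_of_le_Adeg hD
  obtain ⟨g₀, hg₀, hne₀⟩ := D.exists_mem_ne_zero_of_ne_bot (by rintro rfl; simp at h2)
  obtain ⟨m₀, hm₀, hp₀⟩ := exists_word_wordPairing_ne_zero (hD hg₀) hne₀
  let l : Submodule K (Module.Dual K (FA K)) :=
    Submodule.span K {(wordPairing K (Fin 2)).flip (word K m₀)}
  have hl : Module.finrank K l ≤ 1 := by
    simpa using finrank_span_le_card (R := K)
      ({(wordPairing K (Fin 2)).flip (word K m₀)} : Set (Module.Dual K (FA K)))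
  have hle := finrank_le_finrank_inf_dualCoannihilator_add D l
  obtain ⟨g₁, ⟨hg₁, hg₁'⟩, hne₁⟩ := (D ⊓ l.dualCoannihilator).exists_mem_ne_zero_of_ne_bot
    (by intro h; rw [h, finrank_bot] at hle; omega)
  have h10 : ⟪g₁, word K m₀⟫ = 0 :=
    (Submodule.mem_dualCoannihilator _).1 hg₁' _ (Submodule.mem_span_singleton_self _)
  obtain ⟨m₁, hm₁, hp₁⟩ := exists_word_wordPairing_ne_zero (hD hg₁) hne₁
  refine ⟨![(⟪g₀, word K m₀⟫)⁻¹ • (g₀ - (⟪g₀, word K m₁⟫ * (⟪g₁, word K m₁⟫)⁻¹) • g₁),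
    (⟪g₁, word K m₁⟫)⁻¹ • g₁], ![m₀, m₁], ?_, ?_, ?_⟩
  · intro i
    fin_cases i
    · exact D.smul_mem _ (D.sub_mem hg₀ (D.smul_mem _ hg₁))
    · exact D.smul_mem _ hg₁
  · intro i
    fin_cases i
    exacts [hm₀, hm₁]
  · intro i j
    fin_cases i <;> fin_cases j <;> simp [h10, hp₀, hp₁]

theorem wordPairing_prod_prod {L : ℕ} {g : Fin 2 → FA K} {m : Fin 2 → List (Fin 2)}
    (hg : ∀ i, g i ∈ Adeg K L) (hm : ∀ i, (m i).length = L)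
    (hgm : ∀ i j, ⟪g i, word K (m j)⟫ = if i = j then 1 else 0) :
    ∀ w w' : List (Fin 2), w.length = w'.length →
      ⟪(w.map g).prod, (w'.map fun i => word K (m i)).prod⟫ = if w = w' then 1 else 0
  | [], [], _ => by simpa using wordPairing_word (K := K) ([] : List (Fin 2)) []
  | i :: w, j :: w', h => by
    rw [List.map_cons, List.map_cons, List.prod_cons, List.prod_cons,
      wordPairing_mul_mul (hg i) (word_mem_Adeg' (hm j)), hgm,
      wordPairing_prod_prod hg hm hgm w w' (by simpa using h)]
    by_cases h1 : i = j <;> by_cases h2 : w = w' <;> simp [h1, h2]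

theorem list_prod_mem_pow {D : Submodule K (FA K)} {g : Fin 2 → FA K} (hg : ∀ i, g i ∈ D) :
    ∀ w : List (Fin 2), (w.map g).prod ∈ D ^ w.length
  | [] => by simp [Submodule.one_le.1 le_rfl]
  | i :: w => by
    rw [List.map_cons, List.prod_cons, List.length_cons, pow_succ']
    exact Submodule.mul_mem_mul (hg i) (list_prod_mem_pow hg w)

theorem two_pow_le_finrank_pow {D : Submodule K (FA K)} {L : ℕ} (hD : D ≤ Adeg K L)
    (h2 : Module.finrank K D = 2) (h : ℕ) :
    2 ^ h ≤ Module.finrank K (D ^ h : Submodule K (FA K)) := by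
  obtain ⟨g, m, hg, hm, hgm⟩ := exists_dual_words hD h2
  have := finiteDimensional_pow hD h
  let b : (Fin h → Fin 2) → (D ^ h : Submodule K (FA K)) := fun c =>
    ⟨((List.ofFn c).map g).prod, by simpa using list_prod_mem_pow hg (List.ofFn c)⟩
  have hb : LinearIndependent K b := by
    rw [Fintype.linearIndependent_iff]
    intro a ha c
    have h1 := congrArg (fun x : (D ^ h : Submodule K (FA K)) =>
      ⟪(x : FA K), ((List.ofFn c).map fun i => word K (m i)).prod⟫) ha
    simp only [AddSubmonoidClass.coe_finsetSum, Submodule.coe_smul, map_sum, map_smul,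
      LinearMap.sum_apply, LinearMap.smul_apply, b] at h1
    have h2 : ∀ c', ⟪((List.ofFn c').map g).prod,
        ((List.ofFn c).map fun i => word K (m i)).prod⟫ = if c' = c then 1 else 0 := by
      intro c'
      rw [wordPairing_prod_prod (fun i => hD (hg i)) hm hgm _ _ (by simp)]
      simp [List.ofFn_inj]
    simpa only [h2, smul_eq_mul, mul_ite, mul_one, mul_zero, Finset.sum_ite_eq', Finset.sum_ite_eq, Finset.mem_univ,
      if_true, ZeroMemClass.coe_zero, map_zero, LinearMap.zero_apply] using h1
  simpa using hb.fintype_card_le_finrank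

end DualWords

section Kill

local notation "⟪" a "," b "⟫" => wordPairing K (Fin 2) a b

/-- Every element of the two-sided ideal generated by `f` is orthogonal to all powers of `D`. -/
def Kill (D : Submodule K (FA K)) (f : FA K) : Prop :=
  ∀ k, ∀ x ∈ D ^ k, ∀ u w, ⟪x, u * f * w⟫ = 0

variable {K}

theorem Kill.mono_pow {D D' : Submodule K (FA K)} {f : FA K} (h : Kill K D f) {n : ℕ}
    (hD : D' ≤ D ^ n) : Kill K D' f := by
  intro k x hx u w
  refine h (n * k) x ?_ u w
  rw [pow_mul]
  exact pow_le_pow_left' hD k hx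

theorem exists_word_split {w : List (Fin 2)} {a b : ℕ} (h : w.length = a + b) :
    ∃ u v, u ∈ Adeg K a ∧ v ∈ Adeg K b ∧ word K w = u * v :=
  ⟨word K (w.take a), word K (w.drop a), word_mem_Adeg' (by simp [h]),
    word_mem_Adeg' (by simp [h]), by rw [← word_append, List.take_append_drop]⟩

theorem wordPairing_eq_zero_of_window {D : Submodule K (FA K)} {N o c j q r : ℕ} {f : FA K}
    (hD : D ≤ Adeg K N)
    (hloc : ∀ u ∈ Adeg K o, ∀ w ∈ Adeg K c, ∀ g ∈ D ^ j, ⟪g, u * f * w⟫ = 0)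
    {x : FA K} (hx : x ∈ D ^ (q + j + r)) {u w : List (Fin 2)}
    (hu : u.length = N * q + o) (hw : w.length = c + N * r) :
    ⟪x, word K u * f * word K w⟫ = 0 := by
  obtain ⟨u₁, u₂, hu₁, hu₂, hu⟩ := exists_word_split (K := K) hu
  obtain ⟨w₁, w₂, hw₁, hw₂, hw⟩ := exists_word_split (K := K) hw
  rw [pow_add, pow_add] at hx
  rw [hu, hw]
  induction hx using Submodule.mul_induction_on' with
  | mem_mul_mem y hy z hz =>
    induction hy using Submodule.mul_induction_on' with
    | mem_mul_mem y hy t ht =>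
      have h1 : u₁ * u₂ * f * (w₁ * w₂) = (u₁ * (u₂ * f * w₁)) * w₂ := by noncomm_ring
      rw [h1, wordPairing_mul_mul' _ _ (pow_le_Adeg hD r hz) hw₂,
        wordPairing_mul_mul (pow_le_Adeg hD q hy) hu₁, hloc u₂ hu₂ w₁ hw₁ t ht]
      simp
    | add a _ b _ ha hb => rw [add_mul, map_add, LinearMap.add_apply, ha, hb, add_zero]
  | add a _ b _ ha hb => rw [map_add, LinearMap.add_apply, ha, hb, add_zero]

theorem kill_of_window {D : Submodule K (FA K)} {N d : ℕ} {f : FA K}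
    (hD : D ≤ Adeg K N) (hf : f ∈ Adeg K d) (h1 : N < d) (h2 : d ≤ 2 * N)
    (hloc₂ : ∀ o c, o + d + c = N * 2 → ∀ u ∈ Adeg K o, ∀ w ∈ Adeg K c, ∀ g ∈ D ^ 2,
      ⟪g, u * f * w⟫ = 0)
    (hloc₃ : ∀ o c, o + d + c = N * 3 → o < N → c < N → ∀ u ∈ Adeg K o, ∀ w ∈ Adeg K c,
      ∀ g ∈ D ^ 3, ⟪g, u * f * w⟫ = 0) : Kill K D f := by
  intro k x hx u w
  induction u using word_induction with
  | h0 => simp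
  | hadd a b ha hb => rw [add_mul, add_mul, map_add, ha, hb, add_zero]
  | hsmul c a ha => simp [ha]
  | hw u =>
    induction w using word_induction with
    | h0 => simp
    | hadd a b ha hb => rw [mul_add, map_add, ha, hb, add_zero]
    | hsmul c a ha => simp [ha]
    | hw w =>
      by_cases hl : N * k = u.length + d + w.length
      swap
      · exact wordPairing_of_ne hl (pow_le_Adeg hD k hx)
          (mul_mem_Adeg (mul_mem_Adeg (word_mem_Adeg u) hf) (word_mem_Adeg w))
      have hN : 0 < N := by omega
      obtain ⟨q, o, ho, hqo⟩ : ∃ q o, o < N ∧ u.length = N * q + o :=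
        ⟨u.length / N, u.length % N, Nat.mod_lt _ hN, (Nat.div_add_mod _ N).symm⟩
      have key : ∀ j, N * j < N * k - N * q + N → j ≤ k - q := by
        intro j hj
        by_contra! hcon
        have h3 : N * (k - q + 1) ≤ N * j := Nat.mul_le_mul_left _ hcon
        rw [mul_add, Nat.mul_sub] at h3
        omega
      by_cases hod : o + d ≤ N * 2
      · obtain ⟨r, rfl⟩ : ∃ r, k = q + 2 + r := by
          have := key 2 (by omega)
          exact ⟨k - q - 2, by omega⟩
        have e : N * (q + 2 + r) = N * q + N * 2 + N * r := by ring
        exact wordPairing_eq_zero_of_window hD (c := N * 2 - (o + d))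
          (hloc₂ o _ (by omega)) hx hqo (by omega)
      · obtain ⟨r, rfl⟩ : ∃ r, k = q + 3 + r := by
          have := key 3 (by omega)
          exact ⟨k - q - 3, by omega⟩
        have e : N * (q + 3 + r) = N * q + N * 3 + N * r := by ring
        exact wordPairing_eq_zero_of_window hD (c := N * 3 - (o + d))
          (hloc₃ o _ (by omega) ho (by omega)) hx hqo (by omega)

theorem wordPairing_congr_left {o b : ℕ} {P : Submodule K (FA K)} (hP : P ≤ Adeg K o)
    {u u₀ : FA K} (hu : u ∈ Adeg K o) (hu₀ : u₀ ∈ Adeg K o) (h : ∀ p ∈ P, ⟪p, u⟫ = ⟪p, u₀⟫)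
    {g : FA K} (hg : g ∈ P * Adeg K b) (x z : FA K) : ⟪g * x, u * z⟫ = ⟪g * x, u₀ * z⟫ := by
  induction hg using Submodule.mul_induction_on' with
  | mem_mul_mem p hp y hy =>
    rw [mul_assoc, wordPairing_mul_mul (hP hp) hu, wordPairing_mul_mul (hP hp) hu₀, h p hp]
  | add a _ b _ ha hb => rw [add_mul, map_add, LinearMap.add_apply, ha, hb, LinearMap.add_apply]

theorem wordPairing_congr_right {c b : ℕ} {S : Submodule K (FA K)} (hS : S ≤ Adeg K c)
    {w w₀ : FA K} (hw : w ∈ Adeg K c) (hw₀ : w₀ ∈ Adeg K c) (h : ∀ s ∈ S, ⟪s, w⟫ = ⟪s, w₀⟫)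
    {g : FA K} (hg : g ∈ Adeg K b * S) (x z : FA K) : ⟪x * g, z * w⟫ = ⟪x * g, z * w₀⟫ := by
  induction hg using Submodule.mul_induction_on' with
  | mem_mul_mem y hy s hs =>
    rw [← mul_assoc, wordPairing_mul_mul' _ _ (hS hs) hw, wordPairing_mul_mul' _ _ (hS hs) hw₀,
      h s hs]
  | add a _ b _ ha hb => rw [mul_add, map_add, LinearMap.add_apply, ha, hb, LinearMap.add_apply]

variable (K) in
/-- The functional `g ↦ ⟪s * g * p, f⟫`, bilinear in `s` and `p`. -/
def sandwichForm (f : FA K) : FA K →ₗ[K] FA K →ₗ[K] Module.Dual K (FA K) :=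
  LinearMap.mk₂ K
    (fun s p => ((wordPairing K (Fin 2)).flip f) ∘ₗ LinearMap.mulRight K p ∘ₗ LinearMap.mulLeft K s)
    (fun _ _ _ => LinearMap.ext fun _ => by simp [add_mul])
    (fun _ _ _ => LinearMap.ext fun _ => by simp)
    (fun _ _ _ => LinearMap.ext fun _ => by simp [mul_add])
    (fun _ _ _ => LinearMap.ext fun _ => by simp)

variable (K) in
/-- The functional `x ↦ ⟪x, u * f * w⟫`, bilinear in `u` and `w`. -/
def relationForm (f : FA K) : FA K →ₗ[K] FA K →ₗ[K] Module.Dual K (FA K) :=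
  LinearMap.mk₂ K (fun u w => (wordPairing K (Fin 2)).flip (u * f * w))
    (fun _ _ _ => by simp [add_mul])
    (fun _ _ _ => by simp)
    (fun _ _ _ => by simp [mul_add])
    (fun _ _ _ => by simp)

end Kill

section Step

local notation "⟪" a "," b "⟫" => wordPairing K (Fin 2) a b

variable {K}

theorem mul_two_pow_div_le {L C a c p : ℕ} (hL : 0 < L) (h : a + c ≤ L * p) :
    C * 2 ^ (a / L) * (C * 2 ^ (c / L)) ≤ C ^ 2 * 2 ^ p := by
  have h1 : a / L + c / L ≤ p :=
    Nat.div_add_div_le_add_div.trans ((Nat.div_le_div_right h).trans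
      (Nat.mul_div_cancel_left p hL).le)
  calc C * 2 ^ (a / L) * (C * 2 ^ (c / L)) = C ^ 2 * 2 ^ (a / L + c / L) := by rw [pow_add]; ring
    _ ≤ C ^ 2 * 2 ^ p := Nat.mul_le_mul_left _ (Nat.pow_le_pow_right (by norm_num) h1)

theorem Thin.exists_pow_factors {L C h : ℕ} {D : Submodule K (FA K)} (hD : Thin K L C D)
    (h2 : Module.finrank K D = 2) :
    ∃ S P : ℕ → Submodule K (FA K), (∀ a, S a ≤ Adeg K a) ∧ (∀ a, P a ≤ Adeg K a) ∧
      (∀ a, Module.finrank K (S a) ≤ C * 2 ^ (a / L)) ∧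
      (∀ a, Module.finrank K (P a) ≤ C * 2 ^ (a / L)) ∧
      (∀ a b, a + b = L * h → 0 < b → D ^ h ≤ Adeg K b * S a) ∧
      (∀ a b, a + b = L * h → 0 < b → D ^ h ≤ P a * Adeg K b) := by
  have key : ∀ a, ∃ S P : Submodule K (FA K), S ≤ Adeg K a ∧ P ≤ Adeg K a ∧
      Module.finrank K S ≤ C * 2 ^ (a / L) ∧ Module.finrank K P ≤ C * 2 ^ (a / L) ∧
      (∀ b, a + b = L * h → 0 < b → D ^ h ≤ Adeg K b * S) ∧
      (∀ b, a + b = L * h → 0 < b → D ^ h ≤ P * Adeg K b) := by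
    intro a
    by_cases ha : a < L * h
    · obtain ⟨⟨S, h1, h2, h3⟩, P, h4, h5, h6⟩ :=
        hD.exists_pow_le h2 (h := h) (a := a) (b := L * h - a) (by omega) (by omega)
      refine ⟨S, P, h1, h4, h2, h5, ?_, ?_⟩
      · intro b hb _
        obtain rfl : b = L * h - a := by omega
        exact h3
      · intro b hb _
        obtain rfl : b = L * h - a := by omega
        exact h6
    · exact ⟨⊥, ⊥, bot_le, bot_le, by simp, by simp, fun b hb hb' => absurd hb (by omega),
        fun b hb hb' => absurd hb (by omega)⟩
  choose S P h1 h2 h3 h4 h5 h6 using key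
  exact ⟨S, P, h1, h2, h3, h4, h5, h6⟩

theorem wordPairing_mul_mul_mul {o c : ℕ} {u w x y : FA K} (hu : u ∈ Adeg K o)
    (hw : w ∈ Adeg K c) (hx : x ∈ Adeg K o) (hy : y ∈ Adeg K c) (s g p f : FA K) :
    ⟪x * s * g * (p * y), u * f * w⟫ = ⟪x, u⟫ * ⟪s * g * p, f⟫ * ⟪y, w⟫ := by
  rw [show x * s * g * (p * y) = (x * (s * g * p)) * y by noncomm_ring,
    wordPairing_mul_mul' _ _ hy hw, wordPairing_mul_mul hx hu]

theorem three_mul_add_two_le {X β c₂ c₃ g g' : ℕ} (hX : 16 * X ≤ β) (hβ : 2 ≤ β)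
    (h₂ : c₂ ≤ X * β ^ 2) (h₃ : c₃ ≤ X * β ^ 3) (hg : β ^ 4 ≤ g) (hgg' : g ≤ g' + c₃) :
    3 * c₂ + 2 ≤ g' := by
  have b1 : 16 * (X * β ^ 3) ≤ β ^ 4 := by
    calc 16 * (X * β ^ 3) = (16 * X) * β ^ 3 := by ring
      _ ≤ β * β ^ 3 := Nat.mul_le_mul_right _ hX
      _ = β ^ 4 := by ring
  have b2 : X * β ^ 2 ≤ X * β ^ 3 :=
    Nat.mul_le_mul_left _ (Nat.pow_le_pow_right (by omega) (by norm_num))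
  have b3 : 2 ^ 4 ≤ β ^ 4 := Nat.pow_le_pow_left hβ 4
  omega

theorem exists_killed_plane [IsAlgClosed K] {ι : Type*} (f : ι → FA K) (d : ι → ℕ)
    (hhom : ∀ j, f j ∈ Adeg K (d j)) (s : Finset ι) {L C p : ℕ} (hL : 0 < L) (hp : 0 < p)
    {D : Submodule K (FA K)} (hD : Thin K L C D) (h2 : Module.finrank K D = 2)
    (hlow : ∀ j ∈ s, 3 * (L * (4 * p)) ≤ 2 * d j) (hhigh : ∀ j ∈ s, 4 * d j ≤ 7 * (L * (4 * p)))
    (hX : 16 * (s.card * (L * (4 * p)) * C ^ 2) ≤ 2 ^ p) :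
    ∃ D' ≤ D ^ (4 * p), Module.finrank K D' = 2 ∧ ∀ j ∈ s, Kill K D' (f j) := by
  obtain ⟨S, P, hS, hP, hSr, hPr, hDS, hDP⟩ := hD.exists_pow_factors h2 (h := 4 * p)
  set N := L * (4 * p) with hN
  have hNp : N = 4 * (L * p) := by rw [hN]; ring
  have hNpos : 0 < N := by positivity
  have hSf : ∀ a, FiniteDimensional K (S a) := fun a => finiteDimensional_of_le_Adeg (hS a)
  have hPf : ∀ a, FiniteDimensional K (P a) := fun a => finiteDimensional_of_le_Adeg (hP a)
  have hGf := finiteDimensional_pow hD.1 (4 * p)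
  have hG := two_pow_le_finrank_pow hD.1 h2 (4 * p)
  have hGN : D ^ (4 * p) ≤ Adeg K N := pow_le_Adeg hD.1 _
  -- the functionals coming from relations covering a full middle block
  let s₃ := (s ×ˢ Finset.range N).filter fun q => q.2 + N ≤ d q.1
  let F₃ : ι × ℕ → Submodule K (Module.Dual K (FA K)) := fun q =>
    Submodule.map₂ (sandwichForm K (f q.1)) (S q.2) (P (d q.1 - N - q.2))
  obtain ⟨hΦf, hΦ⟩ := finrank_finset_sup_le s₃ F₃ (C ^ 2 * 2 ^ (3 * p))
    (fun q _ => finiteDimensional_map₂ _ _ _) (by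
      intro q hq
      simp only [s₃, Finset.mem_filter, Finset.mem_product] at hq
      have := hhigh _ hq.1.1
      refine (finrank_map₂_le _ _ _).trans ((Nat.mul_le_mul (hSr _) (hPr _)).trans
        (mul_two_pow_div_le hL ?_))
      have e : L * (3 * p) = 3 * (L * p) := by ring
      omega)
  -- the functionals coming from relations inside two consecutive blocks
  choose U hUle hUf hUr hU using fun a => exists_representatives (wordPairing K (Fin 2)) (P a)
    (Adeg K a)
  choose W hWle hWf hWr hW using fun a => exists_representatives (wordPairing K (Fin 2)) (S a)
    (Adeg K a)
  let s₂ := (s ×ˢ Finset.range N).filter fun q => q.2 + d q.1 ≤ N * 2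
  let F₂ : ι × ℕ → Submodule K (Module.Dual K (FA K)) := fun q =>
    Submodule.map₂ (relationForm K (f q.1)) (U q.2) (W (N * 2 - d q.1 - q.2))
  obtain ⟨hTf, hT⟩ := finrank_finset_sup_le s₂ F₂ (C ^ 2 * 2 ^ (2 * p))
    (fun q _ => finiteDimensional_map₂ _ _ _) (by
      intro q hq
      simp only [s₂, Finset.mem_filter, Finset.mem_product] at hq
      have := hlow _ hq.1.1
      refine (finrank_map₂_le _ _ _).trans ((Nat.mul_le_mul ((hUr _).trans (hPr _))
        ((hWr _).trans (hSr _))).trans (mul_two_pow_div_le hL ?_))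
      have e : L * (2 * p) = 2 * (L * p) := by ring
      omega)
  have hcard : ∀ (t : ι × ℕ → Prop) [DecidablePred t],
      ((s ×ˢ Finset.range N).filter t).card ≤ s.card * N := fun t _ =>
    (Finset.card_filter_le _ _).trans (by simp)
  set G' := D ^ (4 * p) ⊓ (s₃.sup F₃).dualCoannihilator with hG'
  have hG'f : FiniteDimensional K G' := Submodule.finiteDimensional_of_le inf_le_left
  have hcount : 3 * Module.finrank K (s₂.sup F₂ : Submodule K (Module.Dual K (FA K))) + 2 ≤
      Module.finrank K G' := by
    have h3 := finrank_le_finrank_inf_dualCoannihilator_add (D ^ (4 * p)) (s₃.sup F₃)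
    have hc2 := hT.trans (Nat.mul_le_mul_right _ (hcard _))
    have hc3 := hΦ.trans (Nat.mul_le_mul_right _ (hcard _))
    have hβ : 2 ≤ 2 ^ p := Nat.le_self_pow (by omega) 2
    rw [mul_comm 2 p, pow_mul, ← mul_assoc] at hc2
    rw [mul_comm 3 p, pow_mul, ← mul_assoc] at hc3
    rw [mul_comm 4 p, pow_mul, mul_comm p 4] at hG
    exact three_mul_add_two_le hX hβ hc2 hc3 hG h3
  obtain ⟨D', hD'G, hD'2, hD'⟩ :=
    exists_isotropic_plane G' (LinearMap.mul K (FA K)) (s₂.sup F₂) hcount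
  have hD'D : D' ≤ D ^ (4 * p) := hD'G.trans inf_le_left
  refine ⟨D', hD'D, hD'2, fun j hj => ?_⟩
  have hl := hlow j hj
  have hh := hhigh j hj
  refine kill_of_window (hD'D.trans hGN) (hhom j) (by omega) (by omega) ?_ ?_
  · intro o c hoc u hu w hw g hg
    rw [pow_two] at hg
    obtain ⟨u₀, hu₀, hu₀'⟩ := hU o u hu
    obtain ⟨w₀, hw₀, hw₀'⟩ := hW c w hw
    induction hg using Submodule.mul_induction_on' with
    | add a _ b _ ha hb => rw [map_add, LinearMap.add_apply, ha, hb, add_zero]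
    | mem_mul_mem g hg g' hg' =>
      rw [mul_assoc, wordPairing_congr_left (hP o) hu (hUle o hu₀) hu₀'
        (hDP o (N - o) (by omega) (by omega) (hD'D hg)), ← mul_assoc,
        wordPairing_congr_right (hS c) hw (hWle c hw₀) hw₀'
        (hDS c (N - c) (by omega) (by omega) (hD'D hg'))]
      refine hD' (relationForm K (f j) u₀ w₀) ?_ g hg g' hg'
      refine Finset.le_sup (f := F₂) (b := (j, o)) ?_ ?_
      · simp only [s₂, Finset.mem_filter, Finset.mem_product, Finset.mem_range]
        exact ⟨⟨hj, by omega⟩, by omega⟩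
      · refine Submodule.apply_mem_map₂ _ hu₀ ?_
        rwa [show N * 2 - d j - o = c by omega]
  · intro o c hoc ho hc u hu w hw g hg
    have hle : D' ^ 3 ≤ (Adeg K o * S (N - o)) * G' * (P (N - c) * Adeg K c) := by
      rw [pow_succ, pow_two]
      exact mul_le_mul' (mul_le_mul' (hD'D.trans (hDS _ _ (by omega) (by omega))) hD'G)
        (hD'D.trans (hDP _ _ (by omega) (by omega)))
    have hmid : ∀ s' ∈ S (N - o), ∀ g ∈ G', ∀ p' ∈ P (N - c), ⟪s' * g * p', f j⟫ = 0 := by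
      intro s' hs' g hg p' hp'
      refine (Submodule.mem_dualCoannihilator _).1 hg.2 (sandwichForm K (f j) s' p') ?_
      refine Finset.le_sup (f := F₃) (b := (j, N - o)) ?_ ?_
      · simp only [s₃, Finset.mem_filter, Finset.mem_product, Finset.mem_range]
        exact ⟨⟨hj, by omega⟩, by omega⟩
      · refine Submodule.apply_mem_map₂ _ hs' ?_
        rwa [show d j - N - (N - o) = N - c by omega]
    replace hg := hle hg
    clear_value G'
    induction hg using Submodule.mul_induction_on' with
    | add a _ b _ ha hb => rw [map_add, LinearMap.add_apply, ha, hb, add_zero]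
    | mem_mul_mem a ha b hb =>
      induction ha using Submodule.mul_induction_on' with
      | add a _ b _ ha hb => rw [add_mul, map_add, LinearMap.add_apply, ha, hb, add_zero]
      | mem_mul_mem a ha g hg =>
        induction ha using Submodule.mul_induction_on' with
        | add a _ b _ ha hb =>
          rw [add_mul, add_mul, map_add, LinearMap.add_apply, ha, hb, add_zero]
        | mem_mul_mem x hx s' hs' =>
          induction hb using Submodule.mul_induction_on' with
          | add a _ b _ ha hb => rw [mul_add, map_add, LinearMap.add_apply, ha, hb, add_zero]
          | mem_mul_mem p' hp' y hy =>
            rw [wordPairing_mul_mul_mul hu hw hx hy, hmid s' hs' g hg p' hp']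
            simp

end Step

section Tower

variable {K}

theorem Thin.exists_plane_pow [IsAlgClosed K] {L C : ℕ} {D : Submodule K (FA K)}
    (hD : Thin K L C D) (h2 : Module.finrank K D = 2) (k : ℕ) :
    ∃ D' ≤ D ^ 2 ^ k, Module.finrank K D' = 2 ∧ Thin K (L * 2 ^ k) (C * 2 ^ k) D' := by
  induction k with
  | zero => exact ⟨D, by simp, h2, by simpa using hD⟩
  | succ k ih =>
    obtain ⟨D', hle, hrk, hthin⟩ := ih
    have hfin := finiteDimensional_pow hthin.1 2
    have h4 := two_pow_le_finrank_pow hthin.1 hrk 2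
    obtain ⟨E, hE, hErk, -⟩ := exists_isotropic_plane (D' ^ 2) (LinearMap.mul K (FA K)) ⊥
      (by simpa using (by norm_num : 2 ≤ 2 ^ 2).trans h4)
    have ht := (hthin.pow (h := 1) hrk).mono hE le_rfl
    refine ⟨E, hE.trans ?_, hErk, ?_⟩
    · rw [pow_succ 2 k, pow_mul]
      exact pow_le_pow_left' hle 2
    · rwa [pow_succ 2 k, ← mul_assoc, ← mul_assoc, ← pow_one (2 : ℕ), ← pow_mul, one_mul]

theorem exists_double_exponent {r q : ℕ} (h3 : 3 ≤ r) (hq : 3 ≤ q) (hr : r < 2 ^ 2 ^ (q - 3)) :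
    ∃ t, t + 2 ≤ q ∧ r ^ 2 ≤ 2 ^ 2 ^ t ∧ 2 ^ 2 ^ t ≤ r ^ 4 := by
  have hex : r ^ 2 ≤ 2 ^ 2 ^ (q - 2) := by
    rw [show q - 2 = q - 3 + 1 by omega, pow_succ 2 (q - 3), pow_mul]
    exact Nat.pow_le_pow_left hr.le 2
  have hE : ∃ t, r ^ 2 ≤ 2 ^ 2 ^ t := ⟨_, hex⟩
  have hle := Nat.find_min' hE hex
  refine ⟨Nat.find hE, by omega, Nat.find_spec hE, ?_⟩
  rcases h0 : Nat.find hE with _ | t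
  · exact le_trans (by norm_num) (Nat.pow_le_pow_left h3 4)
  · have hlt := Nat.find_min hE (m := t) (by omega)
    rw [pow_succ 2 t, pow_mul, show 4 = 2 * 2 from rfl, pow_mul r]
    exact Nat.pow_le_pow_left (not_le.1 hlt).le 2

theorem exists_pow_lt_le {d : ℕ} (h : ∃ n : ℕ, 2 ≤ n ∧ 2 ^ n + 2 ^ (n - 1) ≤ d ∧
      d ≤ 2 ^ n + 2 ^ (n - 1) + 2 ^ (n - 2)) :
    ∃ n, 1 ≤ n ∧ 2 ^ n < d ∧ d ≤ 2 ^ (n + 1) ∧ 3 * 2 ^ n ≤ 2 * d ∧ 4 * d ≤ 7 * 2 ^ n := by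
  obtain ⟨n, hn, h1, h2⟩ := h
  obtain ⟨k, rfl⟩ : ∃ k, n = k + 2 := ⟨n - 2, by omega⟩
  have e1 : 2 ^ (k + 2) = 4 * 2 ^ k := by ring
  have e2 : 2 ^ (k + 2 - 1) = 2 * 2 ^ k := by rw [show k + 2 - 1 = k + 1 by omega]; ring
  have e3 : 2 ^ (k + 2 - 2) = 2 ^ k := by simp
  have e4 : 2 ^ (k + 2 + 1) = 8 * 2 ^ k := by ring
  have e5 : 0 < 2 ^ k := by positivity
  exact ⟨k + 2, by omega, by omega, by omega, by omega, by omega⟩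

theorem eq_of_pow_lt_le {d n m : ℕ} (h1 : 2 ^ n < d) (h2 : d ≤ 2 ^ (n + 1)) (h3 : 2 ^ m < d)
    (h4 : d ≤ 2 ^ (m + 1)) : n = m := by
  have h5 := (Nat.pow_lt_pow_iff_right (by norm_num)).1 (h1.trans_le h4)
  have h6 := (Nat.pow_lt_pow_iff_right (by norm_num)).1 (h3.trans_le h2)
  omega

theorem exists_killing_plane [IsAlgClosed K] (ξ : ℕ) (f : Fin ξ → FA K) (d : Fin ξ → ℕ)
    (hhom : ∀ j, f j ∈ Adeg K (d j))
    (r : ℕ → ℕ)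
    (hr : ∀ i, r i = (Finset.univ.filter fun j => 2 ^ i < d j ∧ d j ≤ 2 ^ (i + 1)).card)
    (Y : Set ℕ) (hYdef : Y = {i : ℕ | 1 ≤ i ∧ r i ≠ 0})
    (hdeg : ∀ j, ∃ n : ℕ, 2 ≤ n ∧ 2 ^ n + 2 ^ (n - 1) ≤ d j ∧
      d j ≤ 2 ^ n + 2 ^ (n - 1) + 2 ^ (n - 2))
    (hmain : ∀ n ∈ Y, ∀ m : ℕ, m = 0 ∨ m ∈ Y → m < n →
      2 ^ (3 * n + 4) * (∏ i ∈ Finset.range n, if i ∈ Y then r i ^ 32 else 1) < r n ∧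
        r n < 2 ^ 2 ^ (n - m - 3)) :
    ∃ N, 0 < N ∧ ∃ D ≤ Adeg K N, Module.finrank K D = 2 ∧ ∀ j, Kill K D (f j) := by
  choose ν hν1 hνlt hνle hνlow hνhigh using fun j => exists_pow_lt_le (hdeg j)
  have hνY : ∀ j, ν j ∈ Y := by
    intro j
    rw [hYdef]
    refine ⟨hν1 j, ?_⟩
    rw [hr]
    exact (Finset.card_pos.2 ⟨j, by simp [hνlt, hνle]⟩).ne'
  let Q : ℕ → ℕ := fun n => ∏ i ∈ Finset.range n, if i ∈ Y then r i ^ 16 else 1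
  have key : ∀ n, n = 0 ∨ n ∈ Y → ∃ C D, Thin K (2 ^ n) C D ∧ Module.finrank K D = 2 ∧
      C ≤ 2 ^ n * Q (n + 1) ∧ ∀ j, d j ≤ 2 ^ (n + 1) → Kill K D (f j) := by
    intro n
    induction n using Nat.strong_induction_on with
    | _ n ih =>
    intro hn
    have h0Y : 0 ∉ Y := by simp [hYdef]
    by_cases hnY : n ∈ Y
    swap
    · obtain rfl := hn.resolve_right hnY
      refine ⟨1, Adeg K 1, thin_one, finrank_Adeg_one, by simp [Q, h0Y], fun j hj => ?_⟩
      have h1 := hνlt j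
      have h2 : 2 ^ 1 ≤ 2 ^ ν j := Nat.pow_le_pow_right (by norm_num) (hν1 j)
      omega
    have hn0 : 0 < n := Nat.pos_of_ne_zero fun h => h0Y (h ▸ hnY)
    -- the predecessor of `n`
    obtain ⟨m, hmn, hm, hmax⟩ : ∃ m < n, (m = 0 ∨ m ∈ Y) ∧ ∀ i ∈ Y, i < n → i ≤ m := by
      have hne : ((Finset.range n).filter fun i => i = 0 ∨ i ∈ Y).Nonempty :=
        ⟨0, by simp [hn0]⟩
      obtain ⟨m, hm, hm'⟩ := Finset.exists_max_image _ id hne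
      simp only [Finset.mem_filter, Finset.mem_range, id] at hm hm'
      exact ⟨m, hm.1, hm.2, fun i hi hin => hm' i ⟨hin, Or.inr hi⟩⟩
    obtain ⟨C, D, hthin, hD2, hC, hkill⟩ := ih m hmn hm
    obtain ⟨hbig, hsmall⟩ := hmain n hnY m hm hmn
    have hQsq : (∏ i ∈ Finset.range n, if i ∈ Y then r i ^ 32 else 1) = Q n ^ 2 := by
      rw [← Finset.prod_pow]
      refine Finset.prod_congr rfl fun i _ => ?_
      split_ifs
      · rw [← pow_mul]
      · simp
    have hQm : Q (m + 1) = Q n := by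
      refine Finset.prod_subset (Finset.range_mono hmn) fun i hi hi' => ?_
      simp only [Finset.mem_range] at hi hi'
      rw [if_neg]
      intro hiY
      have := hmax i hiY hi
      omega
    have hQn : Q (n + 1) = Q n * r n ^ 16 := by
      simp only [Q]
      rw [Finset.prod_range_succ, if_pos hnY]
    have hQpos : 0 < Q n := by
      refine Finset.prod_pos fun i _ => ?_
      split_ifs with hi
      · rw [hYdef] at hi
        exact pow_pos (Nat.pos_of_ne_zero hi.2) _
      · exact one_pos
    rw [hQsq] at hbig
    have hr16 : 16 ≤ r n := by
      have h1 : 2 ^ 4 ≤ 2 ^ (3 * n + 4) := Nat.pow_le_pow_right (by norm_num) (by omega)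
      have h2 : 2 ^ (3 * n + 4) * 1 ≤ 2 ^ (3 * n + 4) * Q n ^ 2 :=
        Nat.mul_le_mul_left _ (Nat.one_le_pow _ _ hQpos)
      omega
    have hnm : 3 ≤ n - m := by
      by_contra! hcon
      rw [show n - m - 3 = 0 by omega] at hsmall
      norm_num at hsmall
      omega
    obtain ⟨t, htq, ht1, ht2⟩ := exists_double_exponent (by omega) hnm hsmall
    obtain ⟨k, rfl⟩ : ∃ k, n = m + k + (t + 2) := ⟨n - m - (t + 2), by omega⟩
    obtain ⟨D₁, hD₁, hD₁2, hthin₁⟩ := hthin.exists_plane_pow hD2 k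
    rw [← pow_add] at hthin₁
    have hN : 2 ^ (m + k) * (4 * 2 ^ t) = 2 ^ (m + k + (t + 2)) := by ring
    generalize hn' : m + k + (t + 2) = n at *
    have hC₁ : C * 2 ^ k ≤ 2 ^ (m + k) * Q n := by
      calc C * 2 ^ k ≤ 2 ^ m * Q (m + 1) * 2 ^ k := Nat.mul_le_mul_right _ hC
        _ = 2 ^ (m + k) * Q n := by rw [hQm]; ring
    have hνeq : ∀ j, 2 ^ n < d j ∧ d j ≤ 2 ^ (n + 1) → ν j = n := fun j hj =>
      eq_of_pow_lt_le (hνlt j) (hνle j) hj.1 hj.2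
    obtain ⟨D', hD', hD'2, hkill'⟩ := exists_killed_plane f d hhom
      (Finset.univ.filter fun j => 2 ^ n < d j ∧ d j ≤ 2 ^ (n + 1))
      (L := 2 ^ (m + k)) (C := C * 2 ^ k) (p := 2 ^ t) (by positivity) (by positivity)
      hthin₁ hD₁2
      (by
        intro j hj
        rw [hN, ← hνeq j (by simpa using hj)]
        exact hνlow j)
      (by
        intro j hj
        rw [hN, ← hνeq j (by simpa using hj)]
        exact hνhigh j)
      (by
        rw [hN, ← hr]
        refine le_trans ?_ ht1
        have h1 : 2 ^ (n + 2 * (m + k) + 4) ≤ 2 ^ (3 * n + 4) :=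
          Nat.pow_le_pow_right (by norm_num) (by omega)
        calc 16 * (r n * 2 ^ n * (C * 2 ^ k) ^ 2)
            ≤ 16 * (r n * 2 ^ n * (2 ^ (m + k) * Q n) ^ 2) := by gcongr
          _ = 2 ^ (n + 2 * (m + k) + 4) * Q n ^ 2 * r n := by ring
          _ ≤ 2 ^ (3 * n + 4) * Q n ^ 2 * r n := by gcongr
          _ ≤ r n * r n := by gcongr
          _ = r n ^ 2 := by ring)
    obtain ⟨h, hh⟩ : ∃ h, 4 * 2 ^ t = h + 1 :=
      ⟨4 * 2 ^ t - 1, by have : 0 < 2 ^ t := by positivity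
                         omega⟩
    refine ⟨C * 2 ^ k * 2 ^ h, D', ?_, hD'2, ?_, ?_⟩
    · rw [← hN, hh]
      exact (hthin₁.pow hD₁2).mono (hh ▸ hD') le_rfl
    · have h1 : 2 ^ h ≤ r n ^ 16 := by
        calc 2 ^ h ≤ 2 ^ (4 * 2 ^ t) := Nat.pow_le_pow_right (by norm_num) (by omega)
          _ = (2 ^ 2 ^ t) ^ 4 := by rw [← pow_mul, mul_comm]
          _ ≤ (r n ^ 4) ^ 4 := Nat.pow_le_pow_left ht2 4
          _ = r n ^ 16 := by rw [← pow_mul]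
      have h2 : 2 ^ (m + k) ≤ 2 ^ n := Nat.pow_le_pow_right (by norm_num) (by omega)
      calc C * 2 ^ k * 2 ^ h ≤ 2 ^ (m + k) * Q n * r n ^ 16 := Nat.mul_le_mul hC₁ h1
        _ ≤ 2 ^ n * Q n * r n ^ 16 := by gcongr
        _ = 2 ^ n * Q (n + 1) := by rw [hQn, mul_assoc]
    · intro j hj
      by_cases hlt : 2 ^ n < d j
      · exact hkill' j (by simp [hlt, hj])
      · have h1 : ν j < n :=
          (Nat.pow_lt_pow_iff_right (by norm_num)).1 ((hνlt j).trans_le (not_lt.1 hlt))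
        have h2 := hmax _ (hνY j) h1
        have h3 : d j ≤ 2 ^ (m + 1) :=
          (hνle j).trans (Nat.pow_le_pow_right (by norm_num) (by omega))
        exact ((hkill j h3).mono_pow hD₁).mono_pow hD'
  obtain ⟨M, hM, hMmax⟩ := Finset.exists_max_image (insert 0 (Finset.univ.image ν)) id
    ⟨0, Finset.mem_insert_self _ _⟩
  obtain ⟨C, D, hthin, hD2, -, hkill⟩ := key M (by
    rcases Finset.mem_insert.1 hM with h | h
    · exact Or.inl h
    · obtain ⟨j, -, rfl⟩ := Finset.mem_image.1 h
      exact Or.inr (hνY j))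
  refine ⟨2 ^ M, by positivity, D, hthin.1, hD2, fun j => hkill j ?_⟩
  exact (hνle j).trans (Nat.pow_le_pow_right (by norm_num)
    (Nat.succ_le_succ (hMmax (ν j) (by simp))))

end Tower

section Core

variable {K}

local notation "⟪" a "," b "⟫" => wordPairing K (Fin 2) a b

/-- The largest two-sided ideal on which all the functionals in `F` vanish. -/
def coreIdeal (F : Set (FA K →ₗ[K] K)) : TwoSidedIdeal (FA K) :=
  TwoSidedIdeal.mk' {a | ∀ φ ∈ F, ∀ u w, φ (u * a * w) = 0} (by simp)
    (fun {a b} ha hb φ hφ u w => by rw [mul_add, add_mul, map_add, ha φ hφ, hb φ hφ, add_zero])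
    (fun {a} ha φ hφ u w => by rw [mul_neg, neg_mul, map_neg, ha φ hφ, neg_zero])
    (fun {a b} hb φ hφ u w => by rw [← mul_assoc, hb φ hφ])
    (fun {a b} ha φ hφ u w => by rw [← mul_assoc, mul_assoc _ b w, ha φ hφ])

theorem mem_coreIdeal {F : Set (FA K →ₗ[K] K)} {a : FA K} :
    a ∈ coreIdeal F ↔ ∀ φ ∈ F, ∀ u w, φ (u * a * w) = 0 := by
  rw [coreIdeal, TwoSidedIdeal.mem_mk']
  rfl

theorem mem_coreIdeal_of_word {F : Set (FA K →ₗ[K] K)} {a : FA K}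
    (h : ∀ φ ∈ F, ∀ u w : List (Fin 2), φ (word K u * a * word K w) = 0) :
    a ∈ coreIdeal F := by
  refine mem_coreIdeal.2 fun φ hφ u w => ?_
  induction u using word_induction with
  | hw u =>
    induction w using word_induction with
    | hw w => exact h φ hφ u w
    | h0 => simp
    | hadd a b ha hb => rw [mul_add, map_add, ha, hb, add_zero]
    | hsmul c a ha => rw [mul_smul_comm, map_smul, ha, smul_zero]
  | h0 => simp
  | hadd a b ha hb => rw [add_mul, add_mul, map_add, ha, hb, add_zero]
  | hsmul c a ha => rw [smul_mul_assoc, smul_mul_assoc, map_smul, ha, smul_zero]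

theorem wordPairing_comm {X : Type*} (a b : FreeAlgebra K X) :
    wordPairing K X a b = wordPairing K X b a := by
  induction a using word_induction with
  | hw w =>
    rw [wordPairing, ← wordBasis_apply, Module.Basis.toDual_apply_left,
      Module.Basis.toDual_apply_right]
  | h0 => simp
  | hadd a b ha hb => simp [ha, hb]
  | hsmul c a ha => simp [ha]

theorem lift_word {R : Type*} [Semiring R] [Algebra K R] (h : Fin 2 → R) (w : List (Fin 2)) :
    FreeAlgebra.lift K h (word K w) = (w.map h).prod := by
  simp [word, map_list_prod, Function.comp_def]

theorem wordPairing_lift {L : ℕ} (hL : 0 < L) {g : Fin 2 → FA K} {m : Fin 2 → List (Fin 2)}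
    (hg : ∀ i, g i ∈ Adeg K L) (hm : ∀ i, (m i).length = L)
    (hgm : ∀ i j, ⟪g i, word K (m j)⟫ = if i = j then 1 else 0) (w : List (Fin 2)) (a : FA K) :
    ⟪(w.map g).prod, FreeAlgebra.lift K (fun i => word K (m i)) a⟫ = ⟪word K w, a⟫ := by
  induction a using word_induction with
  | hw v =>
    rw [lift_word, wordPairing_word]
    by_cases h : w.length = v.length
    · convert wordPairing_prod_prod hg hm hgm w v h
    · rw [if_neg (by rintro rfl; exact h rfl)]
      refine wordPairing_of_ne (n := L * w.length) (m := L * v.length) ?_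
        (pow_le_Adeg le_rfl _ (list_prod_mem_pow hg w))
        (pow_le_Adeg le_rfl _ (list_prod_mem_pow (fun i => word_mem_Adeg' (hm i)) v))
      intro h'
      exact h (Nat.eq_of_mul_eq_mul_left hL h')
  | h0 => simp
  | hadd a b ha hb => simp only [map_add, ha, hb]
  | hsmul c a ha => simp only [map_smul, ha]

theorem exists_free_monomials {I : TwoSidedIdeal (FA K)} {N : ℕ} (hN : 0 < N)
    {D : Submodule K (FA K)} (hD : D ≤ Adeg K N) {g : Fin 2 → FA K} {m : Fin 2 → List (Fin 2)}
    (hg : ∀ i, g i ∈ D) (hm : ∀ i, (m i).length = N)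
    (hgm : ∀ i j, ⟪g i, word K (m j)⟫ = if i = j then 1 else 0) (hI : ∀ a ∈ I, Kill K D a) :
    ∃ (k : ℕ) (m₁ m₂ : FA K), 1 ≤ k ∧ m₁ ∈ Mon K k ∧ m₂ ∈ Mon K k ∧
      Function.Injective (fun p : FreeAlgebra K (Fin 2) =>
        ((FreeAlgebra.lift K ![m₁, m₂]) p : I.ringCon.Quotient)) ∧
      ∀ t : ℕ, 1 ≤ t → ((m₁ : I.ringCon.Quotient)) ^ t ≠ 0 := by
  have hvec : ![word K (m 0), word K (m 1)] = fun i => word K (m i) := by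
    ext i; fin_cases i <;> rfl
  have hker : ∀ p, FreeAlgebra.lift K ![word K (m 0), word K (m 1)] p ∈ I → p = 0 := by
    intro p hp
    have hz : ∀ w, ⟪word K w, p⟫ = 0 := by
      intro w
      rw [← wordPairing_lift hN (fun i => hD (hg i)) hm hgm, ← hvec]
      simpa using hI _ hp _ _ (list_prod_mem_pow hg w) 1 1
    refine eq_zero_of_wordPairing fun w => ?_
    rw [wordPairing_comm, hz w]
  have hinj : Function.Injective (fun p : FreeAlgebra K (Fin 2) =>
      ((FreeAlgebra.lift K ![word K (m 0), word K (m 1)]) p : I.ringCon.Quotient)) := by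
    intro p q hpq
    have h : I.ringCon _ _ := (RingCon.eq _).1 hpq
    rw [TwoSidedIdeal.rel_iff, ← map_sub] at h
    exact sub_eq_zero.1 (hker _ h)
  refine ⟨N, word K (m 0), word K (m 1), hN, ⟨_, hm 0, rfl⟩, ⟨_, hm 1, rfl⟩, hinj, ?_⟩
  intro t _ h0
  have h1 : (FreeAlgebra.ι K (0 : Fin 2)) ^ t = 0 := by
    refine hker _ ?_
    rw [map_pow, FreeAlgebra.lift_ι_apply]
    rw [TwoSidedIdeal.mem_iff]
    exact (RingCon.eq _).1 h0
  have h2 : word K (List.replicate t (0 : Fin 2)) = 0 := by rw [word, List.map_replicate, List.prod_replicate, h1]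
  have h3 := wordPairing_word (K := K) (List.replicate t (0 : Fin 2)) (List.replicate t 0)
  rw [h2] at h3
  simp at h3

theorem kill_of_mem_span {D : Submodule K (FA K)} {s : Set (FA K)} (hs : ∀ a ∈ s, Kill K D a)
    {a : FA K} (ha : a ∈ TwoSidedIdeal.span s) : Kill K D a := by
  have h : TwoSidedIdeal.span s ≤
      coreIdeal {φ : FA K →ₗ[K] K | ∃ k, ∃ x ∈ D ^ k, φ = wordPairing K (Fin 2) x} := by
    rw [TwoSidedIdeal.span_le]
    rintro b hb
    refine mem_coreIdeal.2 ?_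
    rintro _ ⟨k, x, hx, rfl⟩ u w
    exact hs b hb k x hx u w
  exact fun k x hx u w => mem_coreIdeal.1 (h ha) _ ⟨k, x, hx, rfl⟩ u w

end Core

section PowIdeal

variable {K}

local notation "⟪" a "," b "⟫" => wordPairing K (Fin 2) a b

theorem homogComp_of_ne {n m : ℕ} (h : n ≠ m) {a : FA K} (ha : a ∈ Adeg K n) :
    homogComp K m a = 0 := by
  induction ha using Adeg_induction with
  | hw w hw => rw [homogComp_word, if_neg (by omega)]
  | h0 => simp
  | hadd a b _ _ ha hb => rw [map_add, ha, hb, add_zero]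
  | hsmul c a _ ha => rw [map_smul, ha, smul_zero]

theorem homogComp_mul (p : ℕ) (a b : FA K) :
    homogComp K p (a * b) =
      ∑ ij ∈ Finset.HasAntidiagonal.antidiagonal p, homogComp K ij.1 a * homogComp K ij.2 b := by
  induction a using word_induction with
  | hw u =>
    induction b using word_induction with
    | hw v =>
      rw [← word_append, homogComp_word]
      simp only [homogComp_word]
      by_cases h : u.length + v.length = p
      · rw [if_pos (by simpa using h), Finset.sum_eq_single (u.length, v.length)]
        · simp [word_append]
        · rintro ⟨i, j⟩ hij hne
          rw [Finset.HasAntidiagonal.mem_antidiagonal] at hij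
          by_cases hi : u.length = i
          · have hj : v.length ≠ j := by
              rintro rfl
              exact hne (by rw [hi])
            simp [hj]
          · simp [hi]
        · intro h'
          exact absurd (Finset.HasAntidiagonal.mem_antidiagonal.2 h) h'
      · rw [if_neg (by simpa using h)]
        refine (Finset.sum_eq_zero ?_).symm
        rintro ⟨i, j⟩ hij
        rw [Finset.HasAntidiagonal.mem_antidiagonal] at hij
        by_cases hi : u.length = i
        · have hj : v.length ≠ j := by
            rintro rfl
            exact h (by rw [hi]; exact hij)
          simp [hj]
        · simp [hi]
    | h0 => simp
    | hadd a b ha hb => simp only [mul_add, map_add, ha, hb, Finset.sum_add_distrib]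
    | hsmul c a ha => simp only [mul_smul_comm, map_smul, ha, Finset.smul_sum]
  | h0 => simp
  | hadd a b ha hb => simp only [add_mul, map_add, ha, hb, Finset.sum_add_distrib]
  | hsmul c a ha => simp only [smul_mul_assoc, map_smul, ha, Finset.smul_sum]

theorem homogComp_add_mul {n : ℕ} {a : FA K} (ha : a ∈ Adeg K n) (m : ℕ) (b : FA K) :
    homogComp K (n + m) (a * b) = a * homogComp K m b := by
  rw [homogComp_mul, Finset.sum_eq_single (n, m)]
  · rw [homogComp_of_mem ha]
  · rintro ⟨i, j⟩ hij hne
    rw [Finset.HasAntidiagonal.mem_antidiagonal] at hij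
    have hi : n ≠ i := by
      rintro rfl
      exact hne (by rw [show j = m by simpa using hij])
    rw [homogComp_of_ne hi ha, zero_mul]
  · intro h
    exact absurd ((Finset.HasAntidiagonal.mem_antidiagonal (a := (n, m))).2 rfl) h

theorem homogComp_mul_add (n : ℕ) (a : FA K) {m : ℕ} {b : FA K} (hb : b ∈ Adeg K m) :
    homogComp K (n + m) (a * b) = homogComp K n a * b := by
  rw [homogComp_mul, Finset.sum_eq_single (n, m)]
  · rw [homogComp_of_mem hb]
  · rintro ⟨i, j⟩ hij hne
    rw [Finset.HasAntidiagonal.mem_antidiagonal] at hij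
    have hj : m ≠ j := by
      rintro rfl
      exact hne (by rw [show i = n by simpa using hij])
    rw [homogComp_of_ne hj hb, mul_zero]
  · intro h
    exact absurd ((Finset.HasAntidiagonal.mem_antidiagonal (a := (n, m))).2 rfl) h

theorem pow_mem_Adeg {N : ℕ} {g : FA K} (hg : g ∈ Adeg K N) (k : ℕ) : g ^ k ∈ Adeg K (N * k) :=
  pow_le_Adeg le_rfl k (Submodule.pow_mem_pow _ hg k)

theorem wordPairing_pow_of_ne {N n k : ℕ} {g a : FA K} (hg : g ∈ Adeg K N) (ha : a ∈ Adeg K n)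
    (h : n ≠ N * k) : ⟪g ^ k, a⟫ = 0 :=
  wordPairing_of_ne h.symm (pow_mem_Adeg hg k) ha

theorem wordPairing_pow_word_pow {N : ℕ} {g v : FA K} (hg : g ∈ Adeg K N)
    (hv : v ∈ Adeg K N) (hgv : ⟪g, v⟫ = 1) (k : ℕ) : ⟪g ^ k, v ^ k⟫ = 1 := by
  induction k with
  | zero =>
    have h := wordPairing_word (K := K) ([] : List (Fin 2)) []
    rwa [if_pos rfl, word_nil] at h
  | succ k ih => rw [pow_succ', pow_succ', wordPairing_mul_mul hg hv, ih, hgv, one_mul]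

/-- The largest two-sided ideal orthogonal to all powers of `g`. -/
def powIdeal (g : FA K) : TwoSidedIdeal (FA K) :=
  coreIdeal {φ | ∃ k, φ = wordPairing K (Fin 2) (g ^ k)}

theorem mem_powIdeal {g a : FA K} : a ∈ powIdeal g ↔ ∀ k u w, ⟪g ^ k, u * a * w⟫ = 0 := by
  rw [powIdeal, mem_coreIdeal]
  constructor
  · exact fun h k => h _ ⟨k, rfl⟩
  · rintro h _ ⟨k, rfl⟩
    exact h k

theorem wordPairing_pow_eq_zero {g a : FA K} (ha : a ∈ powIdeal g) (k : ℕ) : ⟪g ^ k, a⟫ = 0 := by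
  simpa using mem_powIdeal.1 ha k 1 1

theorem mem_powIdeal_of_word {g a : FA K}
    (h : ∀ k, ∀ u w : List (Fin 2), ⟪g ^ k, word K u * a * word K w⟫ = 0) : a ∈ powIdeal g := by
  refine mem_coreIdeal_of_word ?_
  rintro _ ⟨k, rfl⟩
  exact h k

theorem homogComp_mem_powIdeal {N : ℕ} {g : FA K} (hg : g ∈ Adeg K N) {a : FA K}
    (ha : a ∈ powIdeal g) (n : ℕ) : homogComp K n a ∈ powIdeal g := by
  refine mem_powIdeal_of_word fun k u w => ?_
  rw [← homogComp_add_mul (word_mem_Adeg u), ← homogComp_mul_add _ _ (word_mem_Adeg w)]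
  by_cases h : u.length + n + w.length = N * k
  · rw [h, wordPairing_homogComp (pow_mem_Adeg hg k), mem_powIdeal.1 ha]
  · exact wordPairing_pow_of_ne hg (homogComp_mem _ _) h

theorem isHomogTSI_powIdeal {N : ℕ} {g : FA K} (hg : g ∈ Adeg K N) :
    IsHomogTSI K (powIdeal g) := by
  intro a ha
  obtain ⟨M, hM⟩ := exists_sum_homogComp a
  rw [SetLike.mem_coe, hM M le_rfl]
  exact Submodule.sum_mem _ fun n _ =>
    Submodule.subset_span ⟨homogComp_mem_powIdeal hg ha n, n, homogComp_mem n a⟩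

theorem exists_mul_notMem_powIdeal {N n : ℕ} {g a b : FA K} (hg : g ∈ Adeg K N)
    (han : a ∈ Adeg K n) (ha : a ∉ powIdeal g) (hb : b ∉ powIdeal g) :
    ∃ x : List (Fin 2), a * word K x * b ∉ powIdeal g := by
  obtain ⟨k, u, w, hk⟩ : ∃ k, ∃ u w : List (Fin 2), ⟪g ^ k, word K u * a * word K w⟫ ≠ 0 := by
    by_contra! h
    exact ha (mem_powIdeal_of_word h)
  obtain ⟨l, u', w', hl⟩ : ∃ k, ∃ u w : List (Fin 2), ⟪g ^ k, word K u * b * word K w⟫ ≠ 0 := by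
    by_contra! h
    exact hb (mem_powIdeal_of_word h)
  refine ⟨w ++ u', fun h => ?_⟩
  have hdeg := mul_mem_Adeg (mul_mem_Adeg (word_mem_Adeg (K := K) u) han) (word_mem_Adeg w)
  have hNk : u.length + n + w.length = N * k := by
    by_contra h'
    exact hk (wordPairing_pow_of_ne hg hdeg h')
  rw [hNk] at hdeg
  have h' := mem_powIdeal.1 h (k + l) (word K u) (word K w')
  rw [show word K u * (a * word K (w ++ u') * b) * word K w' =
    (word K u * a * word K w) * (word K u' * b * word K w') by
      rw [word_append]; simp only [mul_assoc], pow_add,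
    wordPairing_mul_mul (pow_mem_Adeg hg k) hdeg] at h'
  exact mul_ne_zero hk hl h'

theorem exists_last_homogComp {g a : FA K} (ha : a ∉ powIdeal g) :
    ∃ n, homogComp K n a ∉ powIdeal g ∧ ∀ i, n < i → homogComp K i a ∈ powIdeal g := by
  obtain ⟨M, hM⟩ := exists_sum_homogComp a
  have hzero : ∀ i, M ≤ i → homogComp K i a = 0 := by
    intro i hi
    have h1 := hM i hi
    have h2 := hM (i + 1) (by omega)
    rw [Finset.sum_range_succ, ← h1] at h2
    simpa using h2
  have hex : ∃ n, n ≤ M ∧ homogComp K n a ∉ powIdeal g := by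
    by_contra! h
    refine ha ?_
    rw [hM M le_rfl]
    exact sum_mem fun i hi => h i (Finset.mem_range.1 hi).le
  obtain ⟨n₀, hn₀, hn₀'⟩ := hex
  refine ⟨Nat.findGreatest (fun n => homogComp K n a ∉ powIdeal g) M,
    Nat.findGreatest_spec (P := fun n => homogComp K n a ∉ powIdeal g) hn₀ hn₀', fun i hi => ?_⟩
  by_cases hiM : i ≤ M
  · exact not_not.1 (Nat.findGreatest_is_greatest hi hiM)
  · rw [hzero i (by omega)]
    exact TwoSidedIdeal.zero_mem _

theorem mem_or_mem_of_mul_mem_powIdeal {N : ℕ} {g : FA K} (hg : g ∈ Adeg K N) {a b : FA K}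
    (h : ∀ x, a * x * b ∈ powIdeal g) : a ∈ powIdeal g ∨ b ∈ powIdeal g := by
  by_contra! hab
  obtain ⟨n, hn, hn'⟩ := exists_last_homogComp hab.1
  obtain ⟨m, hm, hm'⟩ := exists_last_homogComp hab.2
  obtain ⟨x, hx⟩ := exists_mul_notMem_powIdeal hg (homogComp_mem n a) hn hm
  refine hx ?_
  have key := homogComp_mem_powIdeal hg (h (word K x)) (n + (x.length + m))
  rw [mul_assoc, homogComp_mul, ← Finset.add_sum_erase _ _
    ((Finset.HasAntidiagonal.mem_antidiagonal (a := (n, x.length + m))).2 rfl),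
    homogComp_add_mul (word_mem_Adeg x)] at key
  rw [mul_assoc]
  refine (add_mem_cancel_right (sum_mem ?_)).1 key
  rintro ⟨i, j⟩ hij
  rw [Finset.mem_erase, Finset.HasAntidiagonal.mem_antidiagonal, Ne, Prod.mk.injEq] at hij
  obtain ⟨hne, hij⟩ := hij
  dsimp only at hij ⊢
  rcases Nat.lt_or_ge n i with hi | hi
  · exact TwoSidedIdeal.mul_mem_right _ _ _ (hn' i hi)
  · obtain ⟨l, rfl⟩ : ∃ l, j = x.length + l := ⟨j - x.length, by omega⟩
    rw [homogComp_add_mul (word_mem_Adeg x)]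
    exact TwoSidedIdeal.mul_mem_left _ _ _ (TwoSidedIdeal.mul_mem_left _ _ _ (hm' l (by omega)))

end PowIdeal

section Periodic

variable {K}

local notation "⟪" a "," b "⟫" => wordPairing K (Fin 2) a b

/-- The functional that pairs the component of degree `n` with `g ^ (n / N)`. -/
def periodicFunctional (N : ℕ) (g : FA K) : FA K →ₗ[K] K :=
  (wordBasis K (Fin 2)).constr K fun w => ⟪g ^ (w.length / N), word K w⟫

theorem periodicFunctional_of_mem {N n : ℕ} {g a : FA K} (ha : a ∈ Adeg K n) :
    periodicFunctional N g a = ⟪g ^ (n / N), a⟫ := by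
  induction ha using Adeg_induction with
  | hw w hw =>
    rw [periodicFunctional, ← wordBasis_apply, Module.Basis.constr_basis, wordBasis_apply, hw]
  | h0 => simp
  | hadd a b _ _ ha hb => rw [map_add, map_add, ha, hb]
  | hsmul c a _ ha => rw [map_smul, map_smul, ha]

theorem periodicFunctional_mul_left {N : ℕ} (hN : 0 < N) {g u : FA K} (hg : g ∈ Adeg K N)
    (hu : u ∈ Adeg K N) (z : FA K) :
    periodicFunctional N g (u * z) = ⟪g, u⟫ * periodicFunctional N g z := by
  induction z using word_induction with
  | hw w =>
    rw [periodicFunctional_of_mem (mul_mem_Adeg hu (word_mem_Adeg w)),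
      periodicFunctional_of_mem (word_mem_Adeg w), Nat.add_div_left _ hN, pow_succ',
      wordPairing_mul_mul hg hu]
  | h0 => simp
  | hadd a b ha hb => rw [mul_add, map_add, map_add, ha, hb, mul_add]
  | hsmul c a ha => rw [mul_smul_comm, map_smul, map_smul, ha, mul_smul_comm]

theorem periodicFunctional_mul_right {N : ℕ} (hN : 0 < N) {g u : FA K} (hg : g ∈ Adeg K N)
    (hu : u ∈ Adeg K N) (z : FA K) :
    periodicFunctional N g (z * u) = periodicFunctional N g z * ⟪g, u⟫ := by
  induction z using word_induction with
  | hw w =>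
    rw [periodicFunctional_of_mem (mul_mem_Adeg (word_mem_Adeg w) hu),
      periodicFunctional_of_mem (word_mem_Adeg w), Nat.add_div_right _ hN, pow_succ,
      wordPairing_mul_mul' _ _ hg hu]
  | h0 => simp
  | hadd a b ha hb => rw [add_mul, map_add, map_add, ha, hb, add_mul]
  | hsmul c a ha => rw [smul_mul_assoc, map_smul, map_smul, ha, smul_mul_assoc]

/-- The largest two-sided ideal on which `periodicFunctional N g` vanishes. -/
def periodicIdeal (N : ℕ) (g : FA K) : TwoSidedIdeal (FA K) :=
  coreIdeal {periodicFunctional N g}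

theorem powIdeal_le_periodicIdeal {N : ℕ} {g : FA K} (hg : g ∈ Adeg K N) :
    powIdeal g ≤ periodicIdeal N g := by
  intro a ha
  refine mem_coreIdeal.2 ?_
  rintro _ rfl u w
  have hJ : u * a * w ∈ powIdeal g :=
    TwoSidedIdeal.mul_mem_right _ _ _ (TwoSidedIdeal.mul_mem_left _ _ _ ha)
  obtain ⟨M, hM⟩ := exists_sum_homogComp (u * a * w)
  rw [hM M le_rfl, map_sum]
  refine Finset.sum_eq_zero fun n _ => ?_
  rw [periodicFunctional_of_mem (homogComp_mem n _)]
  exact wordPairing_pow_eq_zero (homogComp_mem_powIdeal hg hJ n) _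

theorem mem_powIdeal_of_mem_periodicIdeal {N n : ℕ} (hN : 0 < N) {g a : FA K}
    (hg : g ∈ Adeg K N) (ha : a ∈ Adeg K n) (h : a ∈ periodicIdeal N g) : a ∈ powIdeal g := by
  refine mem_powIdeal_of_word fun k u w => ?_
  have hdeg := mul_mem_Adeg (mul_mem_Adeg (word_mem_Adeg (K := K) u) ha) (word_mem_Adeg w)
  by_cases hk : u.length + n + w.length = N * k
  · have h' := mem_coreIdeal.1 h _ rfl (word K u) (word K w)
    rwa [periodicFunctional_of_mem hdeg, hk, Nat.mul_div_cancel_left _ hN] at h'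
  · exact wordPairing_pow_of_ne hg hdeg hk

theorem mem_periodicIdeal_of_short {N : ℕ} (hN : 0 < N) {g a : FA K} (hg : g ∈ Adeg K N)
    (h : ∀ u w : List (Fin 2), u.length < N → w.length < N →
      periodicFunctional N g (word K u * a * word K w) = 0) : a ∈ periodicIdeal N g := by
  refine mem_coreIdeal_of_word ?_
  rintro _ rfl u w
  have hleft : ∀ n, ∀ u w : List (Fin 2), u.length ≤ n → w.length < N →
      periodicFunctional N g (word K u * a * word K w) = 0 := by
    intro n
    induction n with
    | zero => exact fun u w hu hw => h u w (by omega) hw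
    | succ n ih =>
      intro u w hu hw
      by_cases huN : u.length < N
      · exact h u w huN hw
      · rw [← List.take_append_drop N u, word_append, mul_assoc, mul_assoc,
          periodicFunctional_mul_left hN hg (word_mem_Adeg' (by simp; omega)), ← mul_assoc,
          ih _ _ (by simp; omega) hw, mul_zero]
  have hright : ∀ n, ∀ u w : List (Fin 2), w.length ≤ n →
      periodicFunctional N g (word K u * a * word K w) = 0 := by
    intro n
    induction n with
    | zero => exact fun u w hw => hleft _ u w le_rfl (by omega)
    | succ n ih =>
      intro u w hw
      by_cases hwN : w.length < N
      · exact hleft _ u w le_rfl hwN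
      · rw [← List.take_append_drop (w.length - N) w, word_append, ← mul_assoc,
          periodicFunctional_mul_right hN hg (word_mem_Adeg' (by simp; omega)),
          ih _ _ (by simp; omega), zero_mul]
  exact hright _ u w le_rfl

theorem mkLin_eq_zero {J : TwoSidedIdeal (FA K)} {a : FA K} :
    mkLin K J.ringCon a = 0 ↔ a ∈ J := by
  rw [TwoSidedIdeal.mem_iff]
  exact RingCon.eq _

theorem mkLin_surjective (J : TwoSidedIdeal (FA K)) : Function.Surjective (mkLin K J.ringCon) :=
  fun x => Quotient.inductionOn' x fun a => ⟨a, rfl⟩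

theorem finite_periodic {N : ℕ} (hN : 0 < N) {g : FA K} (hg : g ∈ Adeg K N) :
    Module.Finite K (periodicIdeal N g).ringCon.Quotient := by
  have hfin := (List.finite_length_lt (Fin 2) N).to_subtype
  let S := {w : List (Fin 2) | w.length < N}
  let Ψ : FA K →ₗ[K] (S × S → K) := LinearMap.pi fun uw =>
    periodicFunctional N g ∘ₗ (LinearMap.mulRight K (word K uw.2.1)) ∘ₗ
      (LinearMap.mulLeft K (word K uw.1.1))
  have hle : LinearMap.ker Ψ ≤ LinearMap.ker (mkLin K (periodicIdeal N g).ringCon) := by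
    intro a ha
    rw [LinearMap.mem_ker, mkLin_eq_zero]
    exact mem_periodicIdeal_of_short hN hg fun u w hu hw =>
      congrFun (LinearMap.mem_ker.1 ha) (⟨u, hu⟩, ⟨w, hw⟩)
  have hfinS : Finite (S × S) := Finite.instProd
  have h1 : Module.Finite K (FA K ⧸ LinearMap.ker Ψ) :=
    Module.Finite.equiv Ψ.quotKerEquivRange.symm
  refine Module.Finite.of_surjective ((LinearMap.ker Ψ).liftQ _ hle) ?_
  intro x
  obtain ⟨a, rfl⟩ := mkLin_surjective _ x
  exact ⟨Submodule.Quotient.mk a, rfl⟩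

theorem not_finite_powIdeal {N : ℕ} (hN : 0 < N) {g v : FA K} (hg : g ∈ Adeg K N)
    (hv : v ∈ Adeg K N) (hgv : ⟪g, v⟫ = 1) :
    ¬ Module.Finite K (powIdeal g).ringCon.Quotient := by
  intro hfin
  have hli : LinearIndependent K fun k : ℕ => mkLin K (powIdeal g).ringCon (v ^ k) := by
    rw [linearIndependent_iff']
    intro s c hc j hj
    simp only [← map_smul, ← map_sum] at hc
    have h := wordPairing_pow_eq_zero (mkLin_eq_zero.1 hc) j
    rw [map_sum, Finset.sum_eq_single j] at h
    · simpa [wordPairing_pow_word_pow hg hv hgv] using h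
    · intro k _ hkj
      rw [map_smul, wordPairing_pow_of_ne hg (pow_mem_Adeg hv k), smul_zero]
      intro h'
      exact hkj (Nat.eq_of_mul_eq_mul_left hN h')
    · exact fun h' => absurd hj h'
  exact Module.Finite.not_linearIndependent_of_infinite _ hli

/-- The projection of the quotient by `powIdeal g` onto the quotient by `periodicIdeal N g`. -/
def powToPeriodic {N : ℕ} {g : FA K} (hg : g ∈ Adeg K N) :
    (powIdeal g).ringCon.Quotient →ₐ[K] (periodicIdeal N g).ringCon.Quotient :=
  RingCon.factorₐ K (TwoSidedIdeal.ringCon_le_iff.1 (powIdeal_le_periodicIdeal hg))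

theorem powToPeriodic_mkLin {N : ℕ} {g : FA K} (hg : g ∈ Adeg K N) (a : FA K) :
    powToPeriodic hg (mkLin K (powIdeal g).ringCon a) = mkLin K (periodicIdeal N g).ringCon a :=
  rfl

theorem eq_zero_of_powToPeriodic {N n : ℕ} (hN : 0 < N) {g : FA K} (hg : g ∈ Adeg K N)
    {x : (powIdeal g).ringCon.Quotient} (hx : x ∈ (Adeg K n).map (mkLin K (powIdeal g).ringCon))
    (h : powToPeriodic hg x = 0) : x = 0 := by
  obtain ⟨a, ha, rfl⟩ := hx
  rw [powToPeriodic_mkLin, mkLin_eq_zero] at h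
  exact mkLin_eq_zero.2 (mem_powIdeal_of_mem_periodicIdeal hN hg ha h)

theorem rank_map_Adeg_le {N : ℕ} (hN : 0 < N) {g : FA K} (hg : g ∈ Adeg K N) :
    ∃ c : ℕ, ∀ n : ℕ,
      Module.rank K ((Adeg K n).map (mkLin K (powIdeal g).ringCon)) ≤ (c : Cardinal) := by
  have := finite_periodic hN hg
  refine ⟨Module.finrank K (periodicIdeal N g).ringCon.Quotient, fun n => ?_⟩
  rw [Module.finrank_eq_rank]
  refine LinearMap.rank_le_of_injective
    ((powToPeriodic hg).toLinearMap.domRestrict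
      ((Adeg K n).map (mkLin K (powIdeal g).ringCon))) ?_
  rw [← LinearMap.ker_eq_bot, LinearMap.ker_eq_bot']
  exact fun x hx => Subtype.ext (eq_zero_of_powToPeriodic hN hg x.2 hx)

theorem isPrime_powIdeal {N : ℕ} {g : FA K} (hg : g ∈ Adeg K N)
    (a b : (powIdeal g).ringCon.Quotient) (h : ∀ x, a * x * b = 0) : a = 0 ∨ b = 0 := by
  obtain ⟨a, rfl⟩ := mkLin_surjective _ a
  obtain ⟨b, rfl⟩ := mkLin_surjective _ b
  rw [mkLin_eq_zero, mkLin_eq_zero]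
  exact mem_or_mem_of_mul_mem_powIdeal hg fun x => mkLin_eq_zero.1 (h (mkLin K _ x))

theorem isNoetherianRing_powIdeal {N : ℕ} (hN : 0 < N) {g v : FA K} (hg : g ∈ Adeg K N)
    (hv : v ∈ Adeg K N) (hgv : ⟪g, v⟫ = 1) :
    IsNoetherianRing (powIdeal g).ringCon.Quotient ∧
      IsNoetherianRing ((powIdeal g).ringCon.Quotient)ᵐᵒᵖ := by
  have hfin := finite_periodic hN hg
  let G : ℕ → Submodule K (powIdeal g).ringCon.Quotient := fun n =>
    (Adeg K n).map (mkLin K (powIdeal g).ringCon)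
  have hmul : ∀ n m a b, a ∈ G n → b ∈ G m → a * b ∈ G (n + m) := by
    rintro n m _ _ ⟨a, ha, rfl⟩ ⟨b, hb, rfl⟩
    exact ⟨a * b, mul_mem_Adeg ha hb, rfl⟩
  have hone : 1 ∈ G 0 := ⟨1, one_mem_Adeg, rfl⟩
  have htop : ⨆ n, G n = ⊤ := by
    have h : ⨆ n, Adeg K n = ⊤ := by
      rw [eq_top_iff, ← span_range_word, Submodule.span_le]
      rintro _ ⟨w, rfl⟩
      exact Submodule.mem_iSup_of_mem w.length (word_mem_Adeg w)
    rw [← Submodule.map_iSup, h, Submodule.map_top, LinearMap.range_eq_top]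
    exact mkLin_surjective _
  have hprime : ∀ n m a b, a ∈ G n → b ∈ G m → a ≠ 0 → b ≠ 0 →
      ∃ k, ∃ x ∈ G k, a * x * b ≠ 0 := by
    rintro n m _ _ ⟨a, ha, rfl⟩ ⟨b, hb, rfl⟩ ha0 hb0
    rw [Ne, mkLin_eq_zero] at ha0 hb0
    obtain ⟨x, hx⟩ := exists_mul_notMem_powIdeal hg ha ha0 hb0
    exact ⟨x.length, mkLin K _ (word K x), ⟨_, word_mem_Adeg x, rfl⟩, fun h =>
      hx (mkLin_eq_zero.1 h)⟩
  have hpos : ∃ k, 1 ≤ k ∧ ∃ z ∈ G k, z ≠ 0 := by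
    refine ⟨N, hN, mkLin K _ v, ⟨v, hv, rfl⟩, fun h => ?_⟩
    have h' := wordPairing_pow_eq_zero (mkLin_eq_zero.1 h) 1
    rw [pow_one, hgv] at h'
    exact one_ne_zero h'
  refine ⟨isNoetherianRing_of_graded_prime G hmul hone htop (powToPeriodic hg)
    (fun n a ha h => eq_zero_of_powToPeriodic hN hg ha h) hprime hpos, ?_⟩
  have hfin' : FiniteDimensional K ((periodicIdeal N g).ringCon.Quotient)ᵐᵒᵖ :=
    Module.Finite.equiv (MulOpposite.opLinearEquiv K)
  refine isNoetherianRing_of_graded_prime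
    (fun n => (G n).map (MulOpposite.opLinearEquiv K).toLinearMap) ?_ ⟨1, hone, rfl⟩ ?_
    (AlgHom.op (powToPeriodic hg)) ?_ ?_ ?_
  · rintro n m _ _ ⟨a, ha, rfl⟩ ⟨b, hb, rfl⟩
    exact ⟨b * a, add_comm m n ▸ hmul m n b a hb ha, rfl⟩
  · rw [← Submodule.map_iSup, htop, Submodule.map_top, LinearMap.range_eq_top]
    exact (MulOpposite.opLinearEquiv K).surjective
  · rintro n _ ⟨a, ha, rfl⟩ h
    exact congrArg MulOpposite.op
      (eq_zero_of_powToPeriodic hN hg ha (MulOpposite.op_injective h))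
  · rintro n m _ _ ⟨a, ha, rfl⟩ ⟨b, hb, rfl⟩ ha0 hb0
    obtain ⟨k, x, hx, hx0⟩ := hprime m n b a hb ha
      (fun h => hb0 (congrArg MulOpposite.op h)) (fun h => ha0 (congrArg MulOpposite.op h))
    refine ⟨k, _, ⟨x, hx, rfl⟩, fun h => hx0 ?_⟩
    rw [mul_assoc]
    exact MulOpposite.op_injective h
  · obtain ⟨k, hk, z, hz, hz0⟩ := hpos
    exact ⟨k, hk, _, ⟨z, hz, rfl⟩, fun h => hz0 (MulOpposite.op_injective h)⟩

end Periodic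

section StandardIdentity

variable {K}

variable (K) in
/-- The standard polynomial, as an alternating map on an algebra. -/
def standardMap (n : ℕ) (R : Type*) [Ring R] [Algebra K R] :
    R [⋀^Fin n]→ₗ[K] R :=
  MultilinearMap.alternatization (MultilinearMap.mkPiAlgebraFin K n R)

theorem standardMap_apply {n : ℕ} {R : Type*} [Ring R] [Algebra K R] (v : Fin n → R) :
    standardMap K n R v =
      ∑ σ : Equiv.Perm (Fin n), Equiv.Perm.sign σ • (List.ofFn fun i => v (σ i)).prod := by
  simp only [standardMap, MultilinearMap.alternatization_apply, MultilinearMap.domDomCongr_apply,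
    MultilinearMap.mkPiAlgebraFin_apply]

theorem map_standardMap {n : ℕ} {R S : Type*} [Ring R] [Algebra K R] [Ring S] [Algebra K S]
    (φ : R →ₐ[K] S) (v : Fin n → R) :
    φ (standardMap K n R v) = standardMap K n S fun i => φ (v i) := by
  simp only [standardMap_apply, map_sum, map_list_prod, List.map_ofFn, Function.comp_def,
    Units.smul_def, map_zsmul]

theorem standardMap_eq_zero_of_finrank_lt {n : ℕ} {R : Type*} [Ring R] [Algebra K R]
    [FiniteDimensional K R] (h : Module.finrank K R < n) (v : Fin n → R) :
    standardMap K n R v = 0 := by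
  refine AlternatingMap.map_linearDependent _ v fun hv => ?_
  have := hv.fintype_card_le_finrank
  rw [Fintype.card_fin] at this
  omega

theorem standardMap_ι_ne_zero (n : ℕ) :
    standardMap K n (FreeAlgebra K (Fin n)) (FreeAlgebra.ι K) ≠ 0 := by
  intro h
  have h1 := congrArg (fun a => wordPairing K (Fin n) a (word K (List.ofFn id))) h
  have hw : ∀ σ : Equiv.Perm (Fin n), (List.ofFn fun i => FreeAlgebra.ι K (σ i)).prod =
      word K (List.ofFn σ) := fun σ => by
    rw [word, List.map_ofFn]
    rfl
  simp only [standardMap_apply, hw, map_sum, LinearMap.sum_apply, Units.smul_def, map_zsmul,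
    LinearMap.smul_apply, wordPairing_word, map_zero, LinearMap.zero_apply] at h1
  rw [Finset.sum_eq_single 1] at h1
  · simp at h1
  · intro σ _ hσ
    rw [if_neg, smul_zero]
    intro h'
    exact hσ (Equiv.ext fun i => congrFun (List.ofFn_injective h') i)
  · exact fun h' => absurd (Finset.mem_univ _) h'

theorem prod_ofFn_mem_Adeg {n : ℕ} {a : Fin n → FA K} {d : Fin n → ℕ}
    (ha : ∀ i, a i ∈ Adeg K (d i)) : (List.ofFn a).prod ∈ Adeg K (∑ i, d i) := by
  induction n with
  | zero => simpa using one_mem_Adeg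
  | succ n ih =>
    rw [List.ofFn_succ, List.prod_cons, Fin.sum_univ_succ]
    exact mul_mem_Adeg (ha 0) (ih fun i => ha i.succ)

theorem standardMap_mem_Adeg {n : ℕ} {a : Fin n → FA K} {d : Fin n → ℕ}
    (ha : ∀ i, a i ∈ Adeg K (d i)) : standardMap K n (FA K) a ∈ Adeg K (∑ i, d i) := by
  rw [standardMap_apply]
  refine Submodule.sum_mem _ fun σ _ => ?_
  rw [← Equiv.sum_comp σ]
  rcases Int.units_eq_one_or (Equiv.Perm.sign σ) with h | h <;> rw [h]
  · rw [one_smul]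
    exact prod_ofFn_mem_Adeg fun i => ha (σ i)
  · rw [Units.neg_smul, one_smul]
    exact neg_mem (prod_ofFn_mem_Adeg fun i => ha (σ i))

theorem standardMap_powIdeal {N n : ℕ} (hN : 0 < N) {g : FA K} (hg : g ∈ Adeg K N)
    (h : Module.finrank K (periodicIdeal N g).ringCon.Quotient < n) :
    standardMap K n (powIdeal g).ringCon.Quotient = 0 := by
  have hfin := finite_periodic hN hg
  have hmk : ∀ v : Fin n → FA K, standardMap K n (powIdeal g).ringCon.Quotient
      (fun i => mkLin K _ (v i)) = mkLin K _ (standardMap K n (FA K) v) := fun v =>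
    (map_standardMap (RingCon.mkₐ K (powIdeal g).ringCon) v).symm
  have hcomp : (standardMap K n (powIdeal g).ringCon.Quotient).compLinearMap
      (mkLin K (powIdeal g).ringCon) = 0 := by
    refine Module.Basis.ext_alternating (wordBasis K (Fin 2)) fun v _ => ?_
    simp only [wordBasis_apply, AlternatingMap.compLinearMap_apply, AlternatingMap.zero_apply]
    refine eq_zero_of_powToPeriodic hN hg (n := ∑ i, (v i).length) ?_ ?_
    · exact (hmk _).symm ▸ ⟨_, standardMap_mem_Adeg fun i => word_mem_Adeg (v i), rfl⟩
    · rw [map_standardMap]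
      exact standardMap_eq_zero_of_finrank_lt h _
  refine AlternatingMap.ext fun v => ?_
  choose a ha using fun i => mkLin_surjective _ (v i)
  obtain rfl : (fun i => mkLin K (powIdeal g).ringCon (a i)) = v := funext ha
  exact DFunLike.congr_fun hcomp a

theorem exists_polynomial_identity {N : ℕ} (hN : 0 < N) {g : FA K} (hg : g ∈ Adeg K N) :
    ∃ (n : ℕ) (p : FreeAlgebra K (Fin n)), 1 ≤ n ∧ p ≠ 0 ∧
      ∀ φ : FreeAlgebra K (Fin n) →ₐ[K] (powIdeal g).ringCon.Quotient, φ p = 0 := by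
  refine ⟨Module.finrank K (periodicIdeal N g).ringCon.Quotient + 1, _, by omega,
    standardMap_ι_ne_zero _, fun φ => ?_⟩
  rw [map_standardMap, standardMap_powIdeal hN hg (Nat.lt_succ_self _)]
  rfl

end StandardIdentity

/-- **Theorem 0.1.**  Golod–Shafarevich algebras with a reduced number of defining relations
contain free subalgebras and map onto prime Noetherian PI-algebras of linear growth. -/
theorem statement0 [IsAlgClosed K]
    (ξ : ℕ) (f : Fin ξ → FA K) (d : Fin ξ → ℕ)
    (hpos : ∀ j, 1 ≤ d j) (hhom : ∀ j, f j ∈ Adeg K (d j))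
    (r : ℕ → ℕ)
    (hr : ∀ i, r i = (Finset.univ.filter fun j => 2 ^ i < d j ∧ d j ≤ 2 ^ (i + 1)).card)
    (Y : Set ℕ) (hYdef : Y = {i : ℕ | 1 ≤ i ∧ r i ≠ 0})
    (hdeg : ∀ j, ∃ n : ℕ, 2 ≤ n ∧ 2 ^ n + 2 ^ (n - 1) ≤ d j ∧
      d j ≤ 2 ^ n + 2 ^ (n - 1) + 2 ^ (n - 2))
    (I : TwoSidedIdeal (FA K)) (hI : I = TwoSidedIdeal.span (Set.range f))
    (hmain : ∀ n ∈ Y, ∀ m : ℕ, m = 0 ∨ m ∈ Y → m < n →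
      2 ^ (3 * n + 4) * (∏ i ∈ Finset.range n, if i ∈ Y then r i ^ 32 else 1) < r n ∧
        r n < 2 ^ 2 ^ (n - m - 3)) :
    -- (a) two monomials of the same (positive) degree whose images in `A/I` generate a free
    -- subalgebra; in particular the image of `m₁` is not nilpotent
    (∃ (k : ℕ) (m₁ m₂ : FA K), 1 ≤ k ∧ m₁ ∈ Mon K k ∧ m₂ ∈ Mon K k ∧
      Function.Injective (fun p : FreeAlgebra K (Fin 2) =>
        ((FreeAlgebra.lift K ![m₁, m₂]) p : I.ringCon.Quotient)) ∧
      ∀ t : ℕ, 1 ≤ t → ((m₁ : I.ringCon.Quotient)) ^ t ≠ 0) ∧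
    -- (b) a homogeneous two-sided ideal `J ⊇ I` with `A/J` infinite-dimensional, prime,
    -- left and right Noetherian, of linear growth and satisfying a polynomial identity
    (∃ J : TwoSidedIdeal (FA K), I ≤ J ∧ IsHomogTSI K J ∧
      ¬ Module.Finite K J.ringCon.Quotient ∧
      (∀ a b : J.ringCon.Quotient, (∀ x, a * x * b = 0) → a = 0 ∨ b = 0) ∧
      IsNoetherianRing J.ringCon.Quotient ∧
      IsNoetherianRing (J.ringCon.Quotient)ᵐᵒᵖ ∧
      (∃ c : ℕ, ∀ n : ℕ,
        Module.rank K ((Adeg K n).map (mkLin K J.ringCon)) ≤ (c : Cardinal)) ∧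
      (∃ (N : ℕ) (g : FreeAlgebra K (Fin N)), 1 ≤ N ∧ g ≠ 0 ∧
        ∀ φ : FreeAlgebra K (Fin N) →ₐ[K] J.ringCon.Quotient, φ g = 0)) := by
  obtain ⟨N, hN, D, hD, h2, hkill⟩ :=
    exists_killing_plane ξ f d hhom r hr Y hYdef hdeg hmain
  obtain ⟨g, m, hg, hm, hgm⟩ := exists_dual_words hD h2
  have hIkill : ∀ a ∈ I, Kill K D a := by
    intro a ha
    rw [hI] at ha
    exact kill_of_mem_span (Set.forall_mem_range.2 hkill) ha
  have hg0 : g 0 ∈ Adeg K N := hD (hg 0)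
  have hv : word K (m 0) ∈ Adeg K N := word_mem_Adeg' (hm 0)
  have hgv : wordPairing K (Fin 2) (g 0) (word K (m 0)) = 1 := by rw [hgm, if_pos rfl]
  obtain ⟨hleft, hright⟩ := isNoetherianRing_powIdeal hN hg0 hv hgv
  exact ⟨exists_free_monomials hN hD hg hm hgm hIkill, powIdeal (g 0),
    fun a ha => mem_powIdeal.2 fun k u w => hIkill a ha k _ (Submodule.pow_mem_pow _ (hg 0) k) u w,
    isHomogTSI_powIdeal hg0, not_finite_powIdeal hN hg0 hv hgv, isPrime_powIdeal hg0, hleft,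
    hright, rank_map_Adeg_le hN hg0, exists_polynomial_identity hN hg0⟩

end
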